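/- arXiv:1409.1972 — 6 statements merged into one kernel-verified Lean document; each statement's English description precedes it below -/
import Mathlib

section
/- Let $b > 0$ and define the extended function $\alpha^* : (-\tfrac{\pi^2}{8b^2}, \infty) \to \mathbb{R}$ by $\alpha^*(\lambda) = \sqrt{2\lambda}\,\tanh(b\sqrt{2\lambda})$ for $\lambda \ge 0$ and $\alpha^*(\lambda) = -\sqrt{-2\lambda}\,\tan(b\sqrt{-2\lambda})$ for $-\tfrac{\pi^2}{8b^2} < \lambda < 0$. Then $\alpha^*$ is infinitely differentiable on $(-\tfrac{\pi^2}{8b^2}, \infty)$, strictly increasing, strictly concave, and maps $(-\tfrac{\pi^2}{8b^2}, \infty)$ onto $\mathbb{R}$. -/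
open scoped Real

/-- The smooth extension of `λ ↦ √(2λ) tanh(b√(2λ))` to `(-π²/(8b²), ∞)`, given for
negative arguments by `-√(-2λ) tan(b√(-2λ))`. -/
noncomputable def alphaStar (b lam : ℝ) : ℝ :=
  if 0 ≤ lam then Real.sqrt (2 * lam) * Real.tanh (b * Real.sqrt (2 * lam))
  else -(Real.sqrt (-(2 * lam)) * Real.tan (b * Real.sqrt (-(2 * lam))))

open Filter Topology Set

/-- The entire function whose value at `s ^ 2` is `sinh s / s`. -/
noncomputable def sinhcSqrt (x : ℝ) : ℝ :=
  FormalMultilinearSeries.ofScalarsSum (fun n : ℕ => (((2 * n + 1).factorial : ℝ))⁻¹) x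

/-- The entire function whose value at `s ^ 2` is `cosh s`. -/
noncomputable def coshSqrt (x : ℝ) : ℝ := 1 + x / 2 * sinhcSqrt (x / 4) ^ 2

/-- The smooth function whose value at `s ^ 2` is `s * tanh s`. -/
noncomputable def sqrtMulTanhSqrt (x : ℝ) : ℝ := x * sinhcSqrt x / coshSqrt x

lemma sinhcSqrt_eq_tsum (x : ℝ) :
    sinhcSqrt x = ∑' n : ℕ, (((2 * n + 1).factorial : ℝ))⁻¹ * x ^ n := by
  simp [sinhcSqrt, FormalMultilinearSeries.ofScalarsSum_eq_tsum]

lemma contDiff_sinhcSqrt : ContDiff ℝ (⊤ : ℕ∞) sinhcSqrt := by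
  have hr : (FormalMultilinearSeries.ofScalars ℝ
      (fun n : ℕ => (((2 * n + 1).factorial : ℝ))⁻¹)).radius = ⊤ := by
    apply FormalMultilinearSeries.ofScalars_radius_eq_top_of_tendsto
    · exact Eventually.of_forall fun n => by positivity
    · refine squeeze_zero (fun n => by positivity) (fun n => ?_)
        (tendsto_one_div_add_atTop_nhds_zero_nat (𝕜 := ℝ))
      have h : (2 * n.succ + 1).factorial
          = (2 * n + 3) * ((2 * n + 2) * (2 * n + 1).factorial) := by
        rw [show 2 * n.succ + 1 = (2 * n + 1) + 1 + 1 by omega, Nat.factorial_succ,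
          Nat.factorial_succ]
      rw [h, Real.norm_of_nonneg (by positivity), Real.norm_of_nonneg (by positivity)]
      push_cast
      have hf : ((2 * n + 1).factorial : ℝ) ≠ 0 := by positivity
      have hn : (0 : ℝ) ≤ n := by positivity
      rw [div_le_div_iff₀ (by positivity) (by positivity)]
      field_simp
      nlinarith
  have h := FormalMultilinearSeries.hasFPowerSeriesOnBall _ (by rw [hr]; exact ENNReal.zero_lt_top)
  rw [hr] at h
  have h2 := h.analyticOnNhd
  rw [Metric.eball_top] at h2
  exact (contDiffOn_univ.1 (h2.analyticOn.contDiffOn uniqueDiffOn_univ))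

lemma sinhcSqrt_zero : sinhcSqrt 0 = 1 := by
  simp [sinhcSqrt, FormalMultilinearSeries.ofScalarsSum_zero]

lemma sinhcSqrt_sq_mul (s : ℝ) : sinhcSqrt (s ^ 2) * s = Real.sinh s := by
  rw [sinhcSqrt_eq_tsum, ← tsum_mul_right, ← (Real.hasSum_sinh s).tsum_eq]
  congr 1
  ext n
  rw [← pow_mul, pow_succ]
  ring

lemma sinhcSqrt_neg_sq_mul (s : ℝ) : sinhcSqrt (-s ^ 2) * s = Real.sin s := by
  rw [sinhcSqrt_eq_tsum, ← tsum_mul_right, ← (Real.hasSum_sin s).tsum_eq]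
  congr 1
  ext n
  rw [neg_pow, ← pow_mul, pow_succ]
  ring

lemma coshSqrt_sq (s : ℝ) : coshSqrt (s ^ 2) = Real.cosh s := by
  have h := sinhcSqrt_sq_mul (s / 2)
  have h1 := Real.cosh_two_mul (s / 2)
  have h2 := Real.cosh_sq (s / 2)
  rw [show 2 * (s / 2) = s by ring] at h1
  rw [h1, h2, ← h, coshSqrt, show s ^ 2 / 4 = (s / 2) ^ 2 by ring]
  ring

lemma coshSqrt_neg_sq (s : ℝ) : coshSqrt (-s ^ 2) = Real.cos s := by
  have h := sinhcSqrt_neg_sq_mul (s / 2)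
  have h1 := Real.cos_two_mul (s / 2)
  have h2 := Real.sin_sq_add_cos_sq (s / 2)
  rw [show 2 * (s / 2) = s by ring] at h1
  rw [← h] at h2
  rw [h1, coshSqrt, show -s ^ 2 / 4 = -(s / 2) ^ 2 by ring]
  linear_combination -2 * h2

lemma contDiff_coshSqrt : ContDiff ℝ (⊤ : ℕ∞) coshSqrt := by
  have := contDiff_sinhcSqrt
  unfold coshSqrt
  fun_prop

lemma exists_eq_sq_or_eq_neg_sq (x : ℝ) : ∃ s : ℝ, 0 ≤ s ∧ (x = s ^ 2 ∨ x = -s ^ 2) := by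
  rcases le_total 0 x with h | h
  · exact ⟨√x, Real.sqrt_nonneg _, Or.inl (Real.sq_sqrt h).symm⟩
  · exact ⟨√(-x), Real.sqrt_nonneg _, Or.inr (by rw [Real.sq_sqrt (by linarith)]; ring)⟩

lemma hasDerivAt_sinhcSqrt (x : ℝ) : HasDerivAt sinhcSqrt (deriv sinhcSqrt x) x :=
  (contDiff_sinhcSqrt.differentiable (by simp) x).hasDerivAt

lemma two_mul_mul_deriv_sinhcSqrt (x : ℝ) :
    2 * x * deriv sinhcSqrt x + sinhcSqrt x = coshSqrt x := by
  obtain ⟨s, -, rfl | rfl⟩ := exists_eq_sq_or_eq_neg_sq x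
  · have h := ((hasDerivAt_sinhcSqrt (s ^ 2)).comp s (hasDerivAt_pow 2 s)).mul (hasDerivAt_id s)
    have h' : HasDerivAt Real.sinh _ s :=
      h.congr_of_eventuallyEq (Eventually.of_forall fun t => (sinhcSqrt_sq_mul t).symm)
    have := h'.unique (Real.hasDerivAt_sinh s)
    simp only [id, Function.comp] at this
    rw [coshSqrt_sq, ← this]
    push_cast
    ring
  · have h := ((hasDerivAt_sinhcSqrt (-s ^ 2)).comp s (hasDerivAt_pow 2 s).neg).mul
      (hasDerivAt_id s)
    have h' : HasDerivAt Real.sin _ s :=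
      h.congr_of_eventuallyEq (Eventually.of_forall fun t => (sinhcSqrt_neg_sq_mul t).symm)
    have := h'.unique (Real.hasDerivAt_sin s)
    simp only [id, Function.comp] at this
    rw [coshSqrt_neg_sq, ← this]
    push_cast
    simp
    ring

lemma hasDerivAt_coshSqrt (x : ℝ) : HasDerivAt coshSqrt (sinhcSqrt x / 2) x := by
  have hd : ∀ y, HasDerivAt coshSqrt (deriv coshSqrt y) y := fun y =>
    (contDiff_coshSqrt.differentiable (by simp) y).hasDerivAt
  suffices h : deriv coshSqrt x = sinhcSqrt x / 2 from h ▸ hd x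
  obtain ⟨s, -, h⟩ := exists_eq_sq_or_eq_neg_sq x
  rcases eq_or_ne s 0 with rfl | hs
  · obtain rfl : x = 0 := by simpa using h
    have h1 : DifferentiableAt ℝ (fun x : ℝ => sinhcSqrt (x / 4) ^ 2) 0 := by
      have := contDiff_sinhcSqrt.differentiable (by simp)
      fun_prop
    have h2 := (((hasDerivAt_id (0 : ℝ)).div_const 2).mul h1.hasDerivAt).const_add 1
    have h3 : HasDerivAt coshSqrt _ 0 := h2
    rw [h3.deriv]
    simp [sinhcSqrt_zero]
  · rcases h with rfl | rfl
    · have h := (hd (s ^ 2)).comp s (hasDerivAt_pow 2 s)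
      have h' : HasDerivAt Real.cosh _ s :=
        h.congr_of_eventuallyEq (Eventually.of_forall fun t => (coshSqrt_sq t).symm)
      have := h'.unique (Real.hasDerivAt_cosh s)
      rw [← sinhcSqrt_sq_mul] at this
      apply mul_right_cancel₀ hs
      push_cast at this
      linear_combination this / 2
    · have h := (hd (-s ^ 2)).comp s (hasDerivAt_pow 2 s).neg
      have h' : HasDerivAt Real.cos _ s :=
        h.congr_of_eventuallyEq (Eventually.of_forall fun t => (coshSqrt_neg_sq t).symm)
      have := h'.unique (Real.hasDerivAt_cos s)
      rw [← sinhcSqrt_neg_sq_mul] at this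
      apply mul_right_cancel₀ hs
      push_cast at this
      linear_combination -this / 2

lemma coshSqrt_sq_sub (x : ℝ) : coshSqrt x ^ 2 - x * sinhcSqrt x ^ 2 = 1 := by
  obtain ⟨s, -, rfl | rfl⟩ := exists_eq_sq_or_eq_neg_sq x
  · have := Real.cosh_sq s
    rw [← sinhcSqrt_sq_mul, ← coshSqrt_sq] at this
    linear_combination this
  · have := Real.sin_sq_add_cos_sq s
    rw [← sinhcSqrt_neg_sq_mul, ← coshSqrt_neg_sq] at this
    linear_combination this

lemma lt_pi_div_two_of_neg_sq {s : ℝ} (h : -(π ^ 2 / 4) < -s ^ 2) : s < π / 2 := by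
  have := Real.pi_pos
  by_contra! hs
  nlinarith

lemma coshSqrt_pos {x : ℝ} (hx : -(π ^ 2 / 4) < x) : 0 < coshSqrt x := by
  obtain ⟨s, hs, rfl | rfl⟩ := exists_eq_sq_or_eq_neg_sq x
  · rw [coshSqrt_sq]
    exact Real.cosh_pos s
  · rw [coshSqrt_neg_sq]
    have := Real.pi_pos
    exact Real.cos_pos_of_mem_Ioo ⟨by linarith, lt_pi_div_two_of_neg_sq hx⟩

lemma sinhcSqrt_pos {x : ℝ} (hx : -(π ^ 2 / 4) < x) : 0 < sinhcSqrt x := by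
  obtain ⟨s, hs, h⟩ := exists_eq_sq_or_eq_neg_sq x
  rcases hs.eq_or_lt with rfl | hs
  · obtain rfl : x = 0 := by simpa using h
    rw [sinhcSqrt_zero]
    exact one_pos
  · refine pos_of_mul_pos_left ?_ hs.le
    rcases h with rfl | rfl
    · rw [sinhcSqrt_sq_mul]
      exact Real.sinh_pos_iff.2 hs
    · rw [sinhcSqrt_neg_sq_mul]
      have := Real.pi_pos
      have := lt_pi_div_two_of_neg_sq hx
      exact Real.sin_pos_of_pos_of_lt_pi hs (by linarith)

lemma one_lt_sinhcSqrt_mul_coshSqrt {x : ℝ} (hx : 0 < x) :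
    1 < sinhcSqrt x * coshSqrt x := by
  obtain ⟨s, hs, rfl⟩ : ∃ s, 0 < s ∧ x = s ^ 2 :=
    ⟨√x, Real.sqrt_pos.2 hx, (Real.sq_sqrt hx.le).symm⟩
  have h1 := Real.self_lt_sinh_iff.2 hs
  have h2 := Real.one_le_cosh s
  rw [← sinhcSqrt_sq_mul] at h1
  rw [← coshSqrt_sq] at h2
  have : 1 < sinhcSqrt (s ^ 2) := by
    by_contra! h
    nlinarith
  nlinarith

lemma sinhcSqrt_mul_coshSqrt_lt_one {x : ℝ} (hx : x < 0) :
    sinhcSqrt x * coshSqrt x < 1 := by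
  obtain ⟨s, hs, rfl⟩ : ∃ s, 0 < s ∧ x = -s ^ 2 :=
    ⟨√(-x), Real.sqrt_pos.2 (by linarith), by rw [Real.sq_sqrt (by linarith)]; ring⟩
  have h1 := Real.sin_lt (by linarith : 0 < 2 * s)
  rw [Real.sin_two_mul, ← sinhcSqrt_neg_sq_mul, ← coshSqrt_neg_sq] at h1
  by_contra! h
  nlinarith

lemma contDiffOn_sqrtMulTanhSqrt :
    ContDiffOn ℝ (⊤ : ℕ∞) sqrtMulTanhSqrt (Ioi (-(π ^ 2 / 4))) :=
  (contDiff_id.mul contDiff_sinhcSqrt).contDiffOn.div contDiff_coshSqrt.contDiffOn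
    fun _ hx => (coshSqrt_pos hx).ne'

lemma hasDerivAt_sqrtMulTanhSqrt {x : ℝ} (hx : -(π ^ 2 / 4) < x) :
    HasDerivAt sqrtMulTanhSqrt ((sinhcSqrt x / coshSqrt x + (coshSqrt x ^ 2)⁻¹) / 2) x := by
  have hC := (coshSqrt_pos hx).ne'
  have h := ((hasDerivAt_id x).mul (hasDerivAt_sinhcSqrt x)).div (hasDerivAt_coshSqrt x) hC
  convert! h using 1
  have h1 := two_mul_mul_deriv_sinhcSqrt x
  have h2 := coshSqrt_sq_sub x
  simp only [Pi.mul_apply, id]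
  field_simp
  linear_combination -h2 - coshSqrt x * h1

lemma strictMonoOn_sqrtMulTanhSqrt : StrictMonoOn sqrtMulTanhSqrt (Ioi (-(π ^ 2 / 4))) := by
  refine strictMonoOn_of_deriv_pos (convex_Ioi _) contDiffOn_sqrtMulTanhSqrt.continuousOn
    fun x hx => ?_
  rw [interior_Ioi] at hx
  rw [(hasDerivAt_sqrtMulTanhSqrt hx).deriv]
  have := coshSqrt_pos hx
  have := sinhcSqrt_pos hx
  positivity

lemma deriv_tanhcSqrt_add_sech_sq_neg {x : ℝ} (hx : -(π ^ 2 / 4) < x) (h0 : x ≠ 0) :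
    deriv (fun x => (sinhcSqrt x / coshSqrt x + (coshSqrt x ^ 2)⁻¹) / 2) x < 0 := by
  have hC := coshSqrt_pos hx
  have hS := sinhcSqrt_pos hx
  have h := (((hasDerivAt_sinhcSqrt x).div (hasDerivAt_coshSqrt x) hC.ne').add
    (((hasDerivAt_coshSqrt x).pow 2).inv (pow_ne_zero 2 hC.ne'))).div_const 2
  have h1 := two_mul_mul_deriv_sinhcSqrt x
  have h2 := coshSqrt_sq_sub x
  have key : deriv sinhcSqrt x * coshSqrt x - sinhcSqrt x * (sinhcSqrt x / 2)
      = (1 - sinhcSqrt x * coshSqrt x) / (2 * x) := by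
    field_simp
    linear_combination coshSqrt x * h1 + h2
  have hneg : (1 - sinhcSqrt x * coshSqrt x) / (2 * x) < 0 := by
    rcases h0.lt_or_gt with h0 | h0
    · exact div_neg_of_pos_of_neg (by linarith [sinhcSqrt_mul_coshSqrt_lt_one h0]) (by linarith)
    · exact div_neg_of_neg_of_pos (by linarith [one_lt_sinhcSqrt_mul_coshSqrt h0]) (by linarith)
  refine (HasDerivAt.deriv h).trans_lt ?_
  rw [key]
  have h3 : (1 - sinhcSqrt x * coshSqrt x) / (2 * x) / coshSqrt x ^ 2 < 0 :=
    div_neg_of_neg_of_pos hneg (by positivity)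
  have h4 : -(((2 : ℕ) : ℝ) * coshSqrt x ^ (2 - 1) * (sinhcSqrt x / 2)) /
      (coshSqrt x ^ 2) ^ 2 < 0 :=
    div_neg_of_neg_of_pos (neg_neg_of_pos (by positivity)) (by positivity)
  simp only [Pi.pow_apply]
  linarith

lemma strictConcaveOn_sqrtMulTanhSqrt :
    StrictConcaveOn ℝ (Ioi (-(π ^ 2 / 4))) sqrtMulTanhSqrt := by
  have hpi : -(π ^ 2 / 4) < 0 := by have := Real.pi_pos; simp; positivity
  refine StrictAntiOn.strictConcaveOn_of_deriv (convex_Ioi _)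
    contDiffOn_sqrtMulTanhSqrt.continuousOn ?_
  rw [interior_Ioi]
  suffices h : StrictAntiOn (fun x => (sinhcSqrt x / coshSqrt x + (coshSqrt x ^ 2)⁻¹) / 2)
      (Ioi (-(π ^ 2 / 4))) from
    h.congr fun x hx => (hasDerivAt_sqrtMulTanhSqrt hx).deriv.symm
  have hc : ContinuousOn (fun x => (sinhcSqrt x / coshSqrt x + (coshSqrt x ^ 2)⁻¹) / 2)
      (Ioi (-(π ^ 2 / 4))) := by
    have hS := contDiff_sinhcSqrt.continuous.continuousOn (s := Ioi (-(π ^ 2 / 4)))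
    have hC := contDiff_coshSqrt.continuous.continuousOn (s := Ioi (-(π ^ 2 / 4)))
    exact ((hS.div hC fun x hx => (coshSqrt_pos hx).ne').add
      ((hC.pow 2).inv₀ fun x hx => pow_ne_zero 2 (coshSqrt_pos hx).ne')).div_const 2
  rw [← Ioc_union_Ici_eq_Ioi hpi]
  refine StrictAntiOn.union (c := 0) ?_ ?_ (isGreatest_Ioc hpi) isLeast_Ici
  · refine strictAntiOn_of_deriv_neg (convex_Ioc _ _) (hc.mono Ioc_subset_Ioi_self) fun x hx => ?_
    rw [interior_Ioc] at hx
    exact deriv_tanhcSqrt_add_sech_sq_neg hx.1 hx.2.ne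
  · refine strictAntiOn_of_deriv_neg (convex_Ici _) (hc.mono (Ici_subset_Ioi.2 hpi)) fun x hx => ?_
    rw [interior_Ici] at hx
    exact deriv_tanhcSqrt_add_sech_sq_neg (hpi.trans hx) (ne_of_gt hx)

lemma sqrtMulTanhSqrt_sq (s : ℝ) : sqrtMulTanhSqrt (s ^ 2) = s * Real.tanh s := by
  rw [sqrtMulTanhSqrt, coshSqrt_sq, Real.tanh_eq_sinh_div_cosh, ← sinhcSqrt_sq_mul]
  ring

lemma sqrtMulTanhSqrt_neg_sq (s : ℝ) : sqrtMulTanhSqrt (-s ^ 2) = -(s * Real.tan s) := by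
  rw [sqrtMulTanhSqrt, coshSqrt_neg_sq, Real.tan_eq_sin_div_cos, ← sinhcSqrt_neg_sq_mul]
  ring

lemma sub_one_le_mul_tanh (s : ℝ) : s - 1 ≤ s * Real.tanh s := by
  rw [Real.tanh_eq_sinh_div_cosh, ← mul_div_assoc, le_div_iff₀ (Real.cosh_pos s)]
  have h1 := Real.cosh_sub_sinh s
  have h2 : s * Real.exp (-s) ≤ 1 := by
    rw [Real.exp_neg, ← div_eq_mul_inv, div_le_one (Real.exp_pos s)]
    linarith [Real.add_one_le_exp s]
  rw [← h1] at h2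
  linarith [Real.one_le_cosh s]

lemma image_sqrtMulTanhSqrt : sqrtMulTanhSqrt '' Ioi (-(π ^ 2 / 4)) = univ := by
  refine eq_univ_of_forall fun y => ?_
  have hpi := Real.pi_gt_three
  obtain ⟨s, hs1, hs2, hs3⟩ : ∃ s, 1 < s ∧ s < π / 2 ∧ |y| ≤ Real.tan s := by
    have h1 : ∀ᶠ s in 𝓝[<] (π / 2), s ∈ Ioo 1 (π / 2) := Ioo_mem_nhdsLT (by linarith)
    obtain ⟨s, hs, hs'⟩ := (h1.and (Real.tendsto_tan_pi_div_two.eventually_ge_atTop |y|)).exists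
    exact ⟨s, hs.1, hs.2, hs'⟩
  have ha : -s ^ 2 ∈ Ioi (-(π ^ 2 / 4)) := by
    rw [mem_Ioi]
    nlinarith
  have hb : (|y| + 1) ^ 2 ∈ Ioi (-(π ^ 2 / 4)) := by
    rw [mem_Ioi]
    have : 0 < π ^ 2 / 4 := by positivity
    have := sq_nonneg (|y| + 1)
    linarith
  refine isPreconnected_Ioi.intermediate_value ha hb contDiffOn_sqrtMulTanhSqrt.continuousOn
    ⟨?_, ?_⟩
  · rw [sqrtMulTanhSqrt_neg_sq]
    have := neg_abs_le y
    have := abs_nonneg y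
    nlinarith
  · rw [sqrtMulTanhSqrt_sq]
    have := sub_one_le_mul_tanh (|y| + 1)
    linarith [le_abs_self y]

lemma alphaStar_eq {b : ℝ} (hb : 0 < b) (lam : ℝ) :
    alphaStar b lam = b⁻¹ * sqrtMulTanhSqrt (2 * b ^ 2 * lam) := by
  unfold alphaStar
  split_ifs with h
  · have h1 : 2 * b ^ 2 * lam = (b * √(2 * lam)) ^ 2 := by
      rw [mul_pow, Real.sq_sqrt (by linarith)]
      ring
    rw [h1, sqrtMulTanhSqrt_sq]
    field_simp
  · have h1 : 2 * b ^ 2 * lam = -(b * √(-(2 * lam))) ^ 2 := by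
      rw [mul_pow, Real.sq_sqrt (by linarith)]
      ring
    rw [h1, sqrtMulTanhSqrt_neg_sq]
    field_simp

/-- For `b > 0`, the extended function `α*` is infinitely differentiable on
`(-π²/(8b²), ∞)`, strictly increasing there, strictly concave there, and maps
`(-π²/(8b²), ∞)` onto all of `ℝ`. -/
theorem alphaStar_extension_smooth_strictMono_strictConcave_onto (b : ℝ) (hb : 0 < b) :
    ContDiffOn ℝ (⊤ : ℕ∞) (alphaStar b) (Set.Ioi (-(π ^ 2 / (8 * b ^ 2)))) ∧
    StrictMonoOn (alphaStar b) (Set.Ioi (-(π ^ 2 / (8 * b ^ 2)))) ∧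
    StrictConcaveOn ℝ (Set.Ioi (-(π ^ 2 / (8 * b ^ 2)))) (alphaStar b) ∧
    alphaStar b '' Set.Ioi (-(π ^ 2 / (8 * b ^ 2))) = Set.univ := by
  have hf : alphaStar b = fun lam => b⁻¹ * sqrtMulTanhSqrt (2 * b ^ 2 * lam) :=
    funext (alphaStar_eq hb)
  have hb2 : 0 < 2 * b ^ 2 := by positivity
  have hbi : 0 < b⁻¹ := by positivity
  have hend : -(π ^ 2 / 4) = 2 * b ^ 2 * -(π ^ 2 / (8 * b ^ 2)) := by
    field_simp
    ring
  have hmem : ∀ {x}, 2 * b ^ 2 * x ∈ Ioi (-(π ^ 2 / 4)) ↔ x ∈ Ioi (-(π ^ 2 / (8 * b ^ 2))) := by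
    intro x
    rw [hend, mem_Ioi, mem_Ioi, mul_lt_mul_iff_right₀ hb2]
  rw [hf]
  refine ⟨?_, fun x hx y hy hxy => ?_, ⟨convex_Ioi _, fun x hx y hy hxy s t hs ht hst => ?_⟩, ?_⟩
  · exact contDiffOn_const.mul (contDiffOn_sqrtMulTanhSqrt.comp
      (contDiff_const.mul contDiff_id).contDiffOn fun x hx => hmem.2 hx)
  · exact mul_lt_mul_of_pos_left (strictMonoOn_sqrtMulTanhSqrt (hmem.2 hx) (hmem.2 hy)
      (mul_lt_mul_of_pos_left hxy hb2)) hbi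
  · have h := strictConcaveOn_sqrtMulTanhSqrt.2 (hmem.2 hx) (hmem.2 hy)
      (fun h => hxy (mul_left_cancel₀ hb2.ne' h)) hs ht hst
    simp only [smul_eq_mul] at h ⊢
    rw [show 2 * b ^ 2 * (s * x + t * y) = s * (2 * b ^ 2 * x) + t * (2 * b ^ 2 * y) by ring]
    linarith [mul_lt_mul_of_pos_left h hbi]
  · refine eq_univ_of_forall fun y => ?_
    obtain ⟨x, hx, hxy⟩ := image_sqrtMulTanhSqrt.ge (mem_univ (b * y))
    have hx' : 2 * b ^ 2 * (x / (2 * b ^ 2)) = x := by field_simp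
    refine ⟨x / (2 * b ^ 2), hmem.1 (hx'.symm ▸ hx), ?_⟩
    simp only [hx', hxy]
    field_simp
end

section
/- Let $b > 0$ and let $\alpha^* : (-\tfrac{\pi^2}{8b^2}, \infty) \to \mathbb{R}$ be defined by $\alpha^*(\lambda) = \sqrt{2\lambda}\,\tanh(b\sqrt{2\lambda})$ for $\lambda \ge 0$ and $\alpha^*(\lambda) = -\sqrt{-2\lambda}\,\tan(b\sqrt{-2\lambda})$ for $-\tfrac{\pi^2}{8b^2} < \lambda < 0$. Then the second derivative satisfies $(\alpha^*)''(\lambda) < 0$ for every $\lambda \in (-\tfrac{\pi^2}{8b^2}, \infty)$, and the first derivative satisfies $(\alpha^*)'(\lambda) > 0$ for every $\lambda \in (-\tfrac{\pi^2}{8b^2}, \infty)$. -/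
open scoped Real

open Complex in
/-- Partial fraction expansion of the tangent. -/
theorem hasSum_pi_mul_tan_pi_mul {z : ℂ} (hz : 2 * z ∈ integerComplement) :
    HasSum (fun k : ℕ ↦ 8 * z / ((2 * k + 1) ^ 2 - 4 * z ^ 2)) (π * tan (π * z)) := by
  have hz' : z ∈ integerComplement := by
    rintro ⟨n, rfl⟩
    exact hz ⟨2 * n, by push_cast; rfl⟩
  have hcot {w : ℂ} (hw : w ∈ integerComplement) :
      HasSum (cotTerm w) (π * cot (π * w) - 1 / w) := by
    rw [cot_series_rep' hw]
    exact (summable_cotTerm hw).hasSum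
  have hodd : HasSum (fun k : ℕ ↦ cotTerm (2 * z) (2 * k + 1))
      ((π * cot (π * z) - 1 / z) / 2) := by
    refine ((hcot hz').div_const 2).congr_fun fun k ↦ ?_
    have h₁ := integerComplement_add_ne_zero hz' (k + 1)
    have h₂ := integerComplement_add_ne_zero hz' (-(k + 1))
    push_cast at h₁ h₂
    have e₁ : 2 * z - (((2 * k + 1 : ℕ) : ℂ) + 1) = 2 * (z + -(k + 1)) := by push_cast; ring
    have e₂ : 2 * z + (((2 * k + 1 : ℕ) : ℂ) + 1) = 2 * (z + (k + 1)) := by push_cast; ring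
    rw [cotTerm, cotTerm, e₁, e₂, sub_eq_add_neg z]
    field_simp
  have heven : Summable fun k : ℕ ↦ cotTerm (2 * z) (2 * k) :=
    (summable_cotTerm hz).comp_injective fun a b h ↦ by simpa using h
  have htan : ∑' k : ℕ, cotTerm (2 * z) (2 * k) = -(π * tan (π * z)) / 2 := by
    have h := (heven.hasSum.even_add_odd hodd).unique (hcot hz)
    have hs : sin (π * z) ≠ 0 := sin_pi_mul_ne_zero hz'
    have hc : cos (π * z) ≠ 0 := by
      have h2 := sin_pi_mul_ne_zero hz
      rw [mul_left_comm, sin_two_mul] at h2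
      exact right_ne_zero_of_mul h2
    have h0 : z ≠ 0 := integerComplement.ne_zero hz'
    have hcot2 : cot (π * (2 * z)) = (cot (π * z) - tan (π * z)) / 2 := by
      rw [mul_left_comm, cot, cot, tan, sin_two_mul, cos_two_mul']
      field_simp
    rw [hcot2] at h
    rw [eq_sub_of_add_eq h]
    field_simp
    ring
  have hsum := heven.hasSum.mul_left (-2)
  rw [htan] at hsum
  convert! hsum using 1
  · funext k
    have h₁ := integerComplement_add_ne_zero hz (2 * k + 1)
    have h₂ := integerComplement_add_ne_zero hz (-(2 * k + 1))
    push_cast at h₁ h₂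
    rw [cotTerm_identity hz]
    have e : ((2 * k + 1) ^ 2 - 4 * z ^ 2 : ℂ) =
        -((2 * z + (2 * k + 1)) * (2 * z + -(2 * k + 1))) := by ring
    rw [e]
    push_cast
    rw [sub_eq_add_neg (2 * z)]
    field_simp
    ring
  · ring

theorem two_mul_mem_integerComplement {z : ℂ} {t : ℝ} (ht : -1 < t) (ht0 : t ≠ 0)
    (hz : 4 * z ^ 2 = -t) : 2 * z ∈ Complex.integerComplement := by
  rintro ⟨n, hn⟩
  have h : (n : ℝ) ^ 2 = -t := by
    have : (n : ℂ) ^ 2 = -t := by rw [hn, ← hz]; ring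
    exact_mod_cast this
  have hn1 : n ^ 2 < 1 := by
    have : (n : ℝ) ^ 2 < 1 := by linarith
    exact_mod_cast this
  have hn0 : n = 0 := by nlinarith
  rw [hn0] at h
  simp at h
  exact ht0 h

theorem hasSum_div_of_four_mul_sq {z : ℂ} {t : ℝ} (ht : -1 < t) (ht0 : t ≠ 0)
    (hz : 4 * z ^ 2 = -t) :
    HasSum (fun k : ℕ ↦ ((t / ((2 * k + 1) ^ 2 + t) : ℝ) : ℂ))
      (-(π * z * Complex.tan (π * z)) / 2) := by
  have h := (hasSum_pi_mul_tan_pi_mul (two_mul_mem_integerComplement ht ht0 hz)).mul_left (-z / 2)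
  convert! h using 1
  · funext k
    have e : -z / 2 * (8 * z / ((2 * k + 1) ^ 2 - 4 * z ^ 2)) =
        -(4 * z ^ 2) / ((2 * k + 1) ^ 2 - 4 * z ^ 2) := by ring
    rw [e, hz]
    push_cast
    ring
  · ring

/-- The partial fraction expansion of `α*`. -/
theorem hasSum_alphaStar {b lam : ℝ} (hb : 0 < b) (h : -1 < 8 * b ^ 2 / π ^ 2 * lam) :
    HasSum (fun k : ℕ ↦ (8 * b ^ 2 / π ^ 2 * lam) / ((2 * k + 1) ^ 2 + 8 * b ^ 2 / π ^ 2 * lam))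
      (b / 2 * alphaStar b lam) := by
  rcases eq_or_ne lam 0 with rfl | hlam
  · simp [alphaStar]
  have ht0 : 8 * b ^ 2 / π ^ 2 * lam ≠ 0 := by positivity
  have hpi : (π : ℂ) ≠ 0 := by exact_mod_cast Real.pi_ne_zero
  rw [← Complex.hasSum_ofReal]
  rcases lt_or_gt_of_ne hlam with hneg | hpos
  · have hx : ((√(-(2 * lam)) : ℝ) : ℂ) ^ 2 = -(2 * lam) := by
      exact_mod_cast Real.sq_sqrt (by linarith : 0 ≤ -(2 * lam))
    have hs := hasSum_div_of_four_mul_sq (z := b * √(-(2 * lam)) / π) h ht0 (by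
      rw [div_pow, mul_pow, hx]
      push_cast
      ring)
    convert! hs using 1
    rw [alphaStar, if_neg hneg.not_ge, mul_div_cancel₀ _ hpi]
    push_cast
    ring
  · have hx : ((√(2 * lam) : ℝ) : ℂ) ^ 2 = 2 * lam := by
      exact_mod_cast Real.sq_sqrt (by linarith : 0 ≤ 2 * lam)
    have hs := hasSum_div_of_four_mul_sq (z := b * √(2 * lam) * Complex.I / π) h ht0 (by
      rw [div_pow, mul_pow, mul_pow, hx, Complex.I_sq]
      push_cast
      ring)
    convert! hs using 1
    rw [alphaStar, if_pos hpos.le, mul_div_cancel₀ _ hpi, Complex.tan_mul_I]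
    push_cast
    linear_combination (b * √(2 * lam) * Complex.tanh (b * √(2 * lam)) / 2) * Complex.I_sq

theorem summable_inv_odd_sq : Summable fun k : ℕ ↦ ((2 * k + 1 : ℝ) ^ 2)⁻¹ := by
  have h := (Real.summable_nat_pow_inv (p := 2)).2 one_lt_two
  have h' := h.comp_injective (i := fun k : ℕ ↦ 2 * k + 1) fun a b h ↦ by simpa using h
  simpa [Function.comp_def] using h'

theorem odd_sq_add_ge {r t : ℝ} (hr0 : r ≤ 0) (ht : r < t) (k : ℕ) :
    (1 + r) * (2 * k + 1) ^ 2 ≤ (2 * k + 1) ^ 2 + t := by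
  have : (1 : ℝ) ≤ (2 * k + 1) ^ 2 := by
    have : (0 : ℝ) ≤ k := k.cast_nonneg
    nlinarith
  nlinarith

theorem odd_sq_add_pos {t : ℝ} (ht : -1 < t) (k : ℕ) : 0 < (2 * k + 1 : ℝ) ^ 2 + t := by
  have : (0 : ℝ) ≤ k := k.cast_nonneg
  nlinarith

theorem exists_between_neg_one {t : ℝ} (ht : -1 < t) : ∃ r, -1 < r ∧ r < 0 ∧ r < t := by
  obtain ⟨r, h₁, h₂⟩ := exists_between (lt_min (neg_one_lt_zero (R := ℝ)) ht)
  exact ⟨r, h₁, h₂.trans_le (min_le_left _ _), h₂.trans_le (min_le_right _ _)⟩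

theorem norm_div_sq_le {r t : ℝ} (hr : -1 < r) (hr0 : r ≤ 0) (ht : r < t) (k : ℕ) :
    ‖(2 * k + 1 : ℝ) ^ 2 / ((2 * k + 1) ^ 2 + t) ^ 2‖ ≤
      ((1 + r) ^ 2)⁻¹ * ((2 * k + 1 : ℝ) ^ 2)⁻¹ := by
  have hc : (0 : ℝ) < (2 * k + 1) ^ 2 := by positivity
  have hr1 : 0 < 1 + r := by linarith
  rw [Real.norm_of_nonneg (by positivity)]
  calc (2 * k + 1 : ℝ) ^ 2 / ((2 * k + 1) ^ 2 + t) ^ 2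
      ≤ (2 * k + 1 : ℝ) ^ 2 / ((1 + r) * (2 * k + 1) ^ 2) ^ 2 := by
        gcongr
        exact odd_sq_add_ge hr0 ht k
    _ = _ := by field_simp

theorem norm_div_cube_le {r t : ℝ} (hr : -1 < r) (hr0 : r ≤ 0) (ht : r < t) (k : ℕ) :
    ‖-2 * (2 * k + 1 : ℝ) ^ 2 / ((2 * k + 1) ^ 2 + t) ^ 3‖ ≤
      2 * ((1 + r) ^ 3)⁻¹ * ((2 * k + 1 : ℝ) ^ 2)⁻¹ := by
  have hc : (1 : ℝ) ≤ (2 * k + 1) ^ 2 := one_le_pow₀ (by simp)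
  have hr1 : 0 < 1 + r := by linarith
  have hp := odd_sq_add_pos (hr.trans ht) k
  rw [neg_mul, neg_div, norm_neg, Real.norm_of_nonneg (by positivity)]
  calc 2 * (2 * k + 1 : ℝ) ^ 2 / ((2 * k + 1) ^ 2 + t) ^ 3
      ≤ 2 * (2 * k + 1 : ℝ) ^ 2 / ((1 + r) * (2 * k + 1) ^ 2) ^ 3 := by
        gcongr
        exact odd_sq_add_ge hr0 ht k
    _ = 2 * ((1 + r) ^ 3)⁻¹ * ((2 * k + 1 : ℝ) ^ 2)⁻¹ * ((2 * k + 1 : ℝ) ^ 2)⁻¹ := by field_simp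
    _ ≤ _ := mul_le_of_le_one_right (by positivity) (inv_le_one_of_one_le₀ hc)

theorem hasDerivAt_tsum_div {t : ℝ} (ht : -1 < t) :
    HasDerivAt (fun s : ℝ ↦ ∑' k : ℕ, s / ((2 * k + 1) ^ 2 + s))
      (∑' k : ℕ, (2 * k + 1 : ℝ) ^ 2 / ((2 * k + 1) ^ 2 + t) ^ 2) t := by
  obtain ⟨r, hr, hr0, hrt⟩ := exists_between_neg_one ht
  refine hasDerivAt_tsum_of_isPreconnected (summable_inv_odd_sq.mul_left ((1 + r) ^ 2)⁻¹)
    isOpen_Ioi isPreconnected_Ioi (t := Set.Ioi r) (y₀ := 0) (fun k y hy ↦ ?_)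
    (fun k y hy ↦ norm_div_sq_le hr hr0.le hy k) hr0 (by simp) hrt
  have hp := odd_sq_add_pos (hr.trans hy) k
  convert! (hasDerivAt_id y).div ((hasDerivAt_id y).const_add _) hp.ne' using 1
  simp

theorem summable_div_sq {t : ℝ} (ht : -1 < t) :
    Summable fun k : ℕ ↦ (2 * k + 1 : ℝ) ^ 2 / ((2 * k + 1) ^ 2 + t) ^ 2 := by
  obtain ⟨r, hr, hr0, hrt⟩ := exists_between_neg_one ht
  exact .of_norm_bounded (summable_inv_odd_sq.mul_left _) (norm_div_sq_le hr hr0.le hrt)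

theorem summable_div_cube {t : ℝ} (ht : -1 < t) :
    Summable fun k : ℕ ↦ -2 * (2 * k + 1 : ℝ) ^ 2 / ((2 * k + 1) ^ 2 + t) ^ 3 := by
  obtain ⟨r, hr, hr0, hrt⟩ := exists_between_neg_one ht
  exact .of_norm_bounded (summable_inv_odd_sq.mul_left _) (norm_div_cube_le hr hr0.le hrt)

theorem hasDerivAt_tsum_div_sq {t : ℝ} (ht : -1 < t) :
    HasDerivAt (fun s : ℝ ↦ ∑' k : ℕ, (2 * k + 1 : ℝ) ^ 2 / ((2 * k + 1) ^ 2 + s) ^ 2)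
      (∑' k : ℕ, -2 * (2 * k + 1 : ℝ) ^ 2 / ((2 * k + 1) ^ 2 + t) ^ 3) t := by
  obtain ⟨r, hr, hr0, hrt⟩ := exists_between_neg_one ht
  refine hasDerivAt_tsum_of_isPreconnected (summable_inv_odd_sq.mul_left (2 * ((1 + r) ^ 3)⁻¹))
    isOpen_Ioi isPreconnected_Ioi (t := Set.Ioi r) (y₀ := t) (fun k y hy ↦ ?_)
    (fun k y hy ↦ norm_div_cube_le hr hr0.le hy k) hrt (summable_div_sq ht) hrt
  have hp := odd_sq_add_pos (hr.trans hy) k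
  convert! (hasDerivAt_const y ((2 * k + 1 : ℝ) ^ 2)).div
    (((hasDerivAt_id y).const_add ((2 * k + 1 : ℝ) ^ 2)).pow 2) (pow_ne_zero 2 hp.ne') using 1
  simp
  field_simp

theorem tsum_div_sq_pos {t : ℝ} (ht : -1 < t) :
    0 < ∑' k : ℕ, (2 * k + 1 : ℝ) ^ 2 / ((2 * k + 1) ^ 2 + t) ^ 2 := by
  refine (summable_div_sq ht).tsum_pos (fun k ↦ by positivity) 0 ?_
  have := odd_sq_add_pos ht 0
  positivity

theorem tsum_div_cube_neg {t : ℝ} (ht : -1 < t) :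
    ∑' k : ℕ, -2 * (2 * k + 1 : ℝ) ^ 2 / ((2 * k + 1) ^ 2 + t) ^ 3 < 0 := by
  have h (k : ℕ) : 0 < -(-2 * (2 * k + 1 : ℝ) ^ 2 / ((2 * k + 1) ^ 2 + t) ^ 3) := by
    have := odd_sq_add_pos ht k
    rw [neg_mul, neg_div, neg_neg]
    positivity
  have := (summable_div_cube ht).neg.tsum_pos (fun k ↦ (h k).le) 0 (h 0)
  rwa [tsum_neg, neg_pos] at this

/-- For `b > 0`, the extended function `α*` satisfies `(α*)''(λ) < 0` and
`(α*)'(λ) > 0` for every `λ ∈ (-π²/(8b²), ∞)`. -/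
theorem alphaStar_deriv2_neg_deriv_pos (b : ℝ) (hb : 0 < b) :
    ∀ lam ∈ Set.Ioi (-(π ^ 2 / (8 * b ^ 2))),
      deriv (deriv (alphaStar b)) lam < 0 ∧ 0 < deriv (alphaStar b) lam := by
  set c := 8 * b ^ 2 / π ^ 2 with hc
  have hc0 : 0 < c := by positivity
  have hdom {x : ℝ} (hx : x ∈ Set.Ioi (-(π ^ 2 / (8 * b ^ 2)))) : -1 < c * x := by
    have h : -(π ^ 2 / (8 * b ^ 2)) < x := hx
    have := mul_lt_mul_of_pos_left h hc0
    rwa [mul_neg, hc, div_mul_div_cancel₀ (by positivity), div_self (by positivity)] at this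
  have hEq {x : ℝ} (hx : x ∈ Set.Ioi (-(π ^ 2 / (8 * b ^ 2)))) :
      alphaStar b x = 2 / b * ∑' k : ℕ, c * x / ((2 * k + 1) ^ 2 + c * x) := by
    rw [(hasSum_alphaStar hb (hdom hx)).tsum_eq]
    field_simp
  have hd {x : ℝ} (hx : x ∈ Set.Ioi (-(π ^ 2 / (8 * b ^ 2)))) :
      HasDerivAt (alphaStar b)
        (2 / b * (c * ∑' k : ℕ, (2 * k + 1 : ℝ) ^ 2 / ((2 * k + 1) ^ 2 + c * x) ^ 2)) x := by
    have h := ((hasDerivAt_tsum_div (hdom hx)).comp x (hasDerivAt_const_mul c)).const_mul (2 / b)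
    rw [mul_comm _ c] at h
    refine h.congr_of_eventuallyEq ?_
    filter_upwards [isOpen_Ioi.mem_nhds hx] with y hy using hEq hy
  have hdd {x : ℝ} (hx : x ∈ Set.Ioi (-(π ^ 2 / (8 * b ^ 2)))) :
      HasDerivAt (deriv (alphaStar b))
        (2 / b * (c * (c * ∑' k : ℕ,
          -2 * (2 * k + 1 : ℝ) ^ 2 / ((2 * k + 1) ^ 2 + c * x) ^ 3))) x := by
    have h := ((hasDerivAt_tsum_div_sq (hdom hx)).comp x (hasDerivAt_const_mul c)).const_mul c
    replace h := h.const_mul (2 / b)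
    rw [mul_comm _ c] at h
    refine h.congr_of_eventuallyEq ?_
    filter_upwards [isOpen_Ioi.mem_nhds hx] with y hy using (hd hy).deriv
  intro x hx
  rw [(hd hx).deriv, (hdd hx).deriv]
  have h₁ := tsum_div_sq_pos (hdom hx)
  have h₂ := tsum_div_cube_neg (hdom hx)
  have hb2 : 0 < 2 / b := by positivity
  exact ⟨mul_neg_of_pos_of_neg hb2 (mul_neg_of_pos_of_neg hc0 (mul_neg_of_pos_of_neg hc0 h₂)),
    mul_pos hb2 (mul_pos hc0 h₁)⟩
end

section
/- Let $b > 0$ and let $\alpha^* : (-\tfrac{\pi^2}{8b^2}, \infty) \to \mathbb{R}$ be defined by $\alpha^*(\lambda) = \sqrt{2\lambda}\,\tanh(b\sqrt{2\lambda})$ for $\lambda \ge 0$ and $\alpha^*(\lambda) = -\sqrt{-2\lambda}\,\tan(b\sqrt{-2\lambda})$ for $\lambda < 0$. Then for every $x > 0$ there exists a unique $\lambda^*(x) \in (-\tfrac{\pi^2}{8b^2}, \infty)$ such that $(\alpha^*)'(\lambda^*(x)) = 1/x$; moreover the map $x \mapsto \lambda^*(x)$ is continuously differentiable on $(0,\infty)$.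 -/
open scoped Real

open Filter Topology Set

/-- A right inverse, with values in an open set on which `g` is injective and `C¹` with
nonvanishing derivative, is `C¹`. -/
theorem contDiffOn_of_rightInvOn {g h : ℝ → ℝ} {U V : Set ℝ} (hU : IsOpen U)
    (hinj : InjOn g U) (hg : ContDiffOn ℝ 1 g U) (hg' : ∀ u ∈ U, deriv g u ≠ 0)
    (hV : MapsTo h V U) (hVo : IsOpen V) (hgh : RightInvOn h g V) : ContDiffOn ℝ 1 h V := by
  intro y hy
  have hu := hV hy
  have hgc : ContDiffAt ℝ 1 g (h y) := hg.contDiffAt (hU.mem_nhds hu)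
  have hd := (hgc.differentiableAt one_ne_zero).hasDerivAt.hasFDerivAt_equiv (hg' _ hu)
  have hs := hgc.hasStrictFDerivAt' hd one_ne_zero
  have hli := hgc.to_localInverse hd one_ne_zero
  rw [hgh hy] at hli
  refine (hli.congr_of_eventuallyEq ?_).contDiffWithinAt
  have h1 := hs.eventually_right_inverse
  have h2 := hs.localInverse_tendsto.eventually (hU.mem_nhds hu)
  rw [hgh hy] at h1 h2
  filter_upwards [h1, h2, hVo.mem_nhds hy] with z hz1 hz2 hz3
  exact hinj (hV hz3) hz2 ((hgh hz3).trans hz1.symm)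

section PoleSeries

variable {a : ℕ → ℝ} {r : ℝ}

theorem one_sub_div_mul_le_add (h0 : 0 < a 0) (ha : ∀ k, a 0 ≤ a k) (hr0 : 0 ≤ r)
    {x : ℝ} (hx : -r < x) (k : ℕ) : (1 - r / a 0) * a k ≤ a k + x := by
  have : r ≤ r / a 0 * a k := by
    rw [div_mul_eq_mul_div, le_div_iff₀ h0]
    exact mul_le_mul_of_nonneg_left (ha k) hr0
  linarith

theorem norm_div_add_sq_le (h0 : 0 < a 0) (ha : ∀ k, a 0 ≤ a k) (hr0 : 0 ≤ r) (hr : r < a 0)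
    {x : ℝ} (hx : -r < x) (k : ℕ) :
    ‖a k / (a k + x) ^ 2‖ ≤ ((1 - r / a 0) ^ 2)⁻¹ * (a k)⁻¹ := by
  have hk : 0 < a k := h0.trans_le (ha k)
  have hc : 0 < 1 - r / a 0 := by rw [sub_pos, div_lt_one h0]; exact hr
  have hb := one_sub_div_mul_le_add h0 ha hr0 hx k
  have hp : 0 < (1 - r / a 0) * a k := mul_pos hc hk
  rw [Real.norm_of_nonneg (by positivity)]
  calc a k / (a k + x) ^ 2 ≤ a k / ((1 - r / a 0) * a k) ^ 2 := by gcongr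
    _ = _ := by field_simp

theorem norm_div_add_cube_le (h0 : 0 < a 0) (ha : ∀ k, a 0 ≤ a k) (hr0 : 0 ≤ r) (hr : r < a 0)
    {x : ℝ} (hx : -r < x) (k : ℕ) :
    ‖-(2 * a k) / (a k + x) ^ 3‖ ≤ 2 * ((1 - r / a 0) ^ 3)⁻¹ * (a 0)⁻¹ * (a k)⁻¹ := by
  have hk : 0 < a k := h0.trans_le (ha k)
  have hc : 0 < 1 - r / a 0 := by rw [sub_pos, div_lt_one h0]; exact hr
  have hb := one_sub_div_mul_le_add h0 ha hr0 hx k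
  have hp : 0 < (1 - r / a 0) * a k := mul_pos hc hk
  have hq : 0 < a k + x := hp.trans_le hb
  rw [neg_div, norm_neg, Real.norm_of_nonneg (by positivity)]
  calc 2 * a k / (a k + x) ^ 3 ≤ 2 * a k / ((1 - r / a 0) * a k) ^ 3 := by gcongr
    _ = 2 * ((1 - r / a 0) ^ 3)⁻¹ * (a k)⁻¹ * (a k)⁻¹ := by
      generalize 1 - r / a 0 = c at *
      field_simp
    _ ≤ _ := by
      gcongr
      exact ha k

theorem exists_lt_of_neg_lt (h0 : 0 < a 0) {x : ℝ} (hx : -a 0 < x) :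
    ∃ r, 0 ≤ r ∧ r < a 0 ∧ -r < x := by
  obtain ⟨r, hr1, hr2⟩ := exists_between (max_lt h0 (neg_lt.1 hx))
  exact ⟨r, (le_max_left _ _).trans hr1.le, hr2, neg_lt.1 ((le_max_right _ _).trans_lt hr1)⟩

theorem summable_div_add_sq (h0 : 0 < a 0) (ha : ∀ k, a 0 ≤ a k)
    (hs : Summable fun k => (a k)⁻¹) {x : ℝ} (hx : -a 0 < x) :
    Summable fun k => a k / (a k + x) ^ 2 := by
  obtain ⟨r, hr0, hr, hx⟩ := exists_lt_of_neg_lt h0 hx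
  exact .of_norm_bounded (hs.mul_left _) (norm_div_add_sq_le h0 ha hr0 hr hx)

theorem summable_neg_div_add_cube (h0 : 0 < a 0) (ha : ∀ k, a 0 ≤ a k)
    (hs : Summable fun k => (a k)⁻¹) {x : ℝ} (hx : -a 0 < x) :
    Summable fun k => -(2 * a k) / (a k + x) ^ 3 := by
  obtain ⟨r, hr0, hr, hx⟩ := exists_lt_of_neg_lt h0 hx
  exact .of_norm_bounded (hs.mul_left _) (norm_div_add_cube_le h0 ha hr0 hr hx)

theorem hasDerivAt_tsum_div_add (h0 : 0 < a 0) (ha : ∀ k, a 0 ≤ a k)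
    (hs : Summable fun k => (a k)⁻¹) {x : ℝ} (hx : -a 0 < x) :
    HasDerivAt (fun x => ∑' k, x / (a k + x)) (∑' k, a k / (a k + x) ^ 2) x := by
  obtain ⟨r, hr0, hr, hx⟩ := exists_lt_of_neg_lt h0 hx
  obtain ⟨r, hr0, hr, hx, hr1⟩ : ∃ r, 0 ≤ r ∧ r < a 0 ∧ -r < x ∧ -r < 0 := by
    obtain ⟨r', h1, h2⟩ := exists_between hr
    exact ⟨r', by linarith, h2, by linarith, by linarith⟩
  refine hasDerivAt_tsum_of_isPreconnected (hs.mul_left _) isOpen_Ioi isPreconnected_Ioi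
    (fun k y hy => ?_) (fun k y hy => norm_div_add_sq_le h0 ha hr0 hr (x := y) hy k)
    (y₀ := 0) hr1 (by simp) hx
  have hne : a k + y ≠ 0 := by linarith [ha k, mem_Ioi.1 hy]
  refine ((hasDerivAt_id' y).div ((hasDerivAt_id' y).const_add (a k)) hne).congr_deriv ?_
  ring

theorem hasDerivAt_tsum_div_add_sq (h0 : 0 < a 0) (ha : ∀ k, a 0 ≤ a k)
    (hs : Summable fun k => (a k)⁻¹) {x : ℝ} (hx : -a 0 < x) :
    HasDerivAt (fun x => ∑' k, a k / (a k + x) ^ 2) (∑' k, -(2 * a k) / (a k + x) ^ 3) x := by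
  have hx' := hx
  obtain ⟨r, hr0, hr, hx⟩ := exists_lt_of_neg_lt h0 hx
  refine hasDerivAt_tsum_of_isPreconnected (hs.mul_left _) isOpen_Ioi isPreconnected_Ioi
    (fun k y hy => ?_) (fun k y hy => norm_div_add_cube_le h0 ha hr0 hr (x := y) hy k)
    hx (summable_div_add_sq h0 ha hs hx') hx
  have hne : a k + y ≠ 0 := by linarith [ha k, mem_Ioi.1 hy]
  refine ((hasDerivAt_const y (a k)).div (((hasDerivAt_id' y).const_add (a k)).pow 2)
    (pow_ne_zero 2 hne)).congr_deriv ?_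
  simp
  field_simp

theorem continuousOn_tsum_neg_div_add_cube (h0 : 0 < a 0) (ha : ∀ k, a 0 ≤ a k)
    (hs : Summable fun k => (a k)⁻¹) :
    ContinuousOn (fun x => ∑' k, -(2 * a k) / (a k + x) ^ 3) (Ioi (-a 0)) := by
  intro x hx
  obtain ⟨r, hr0, hr, hx⟩ := exists_lt_of_neg_lt h0 hx
  refine ((continuousOn_tsum (s := Ioi (-r)) (fun k => ?_) (hs.mul_left _)
    fun k y hy => norm_div_add_cube_le h0 ha hr0 hr (x := y) hy k).continuousAt
    (Ioi_mem_nhds hx)).continuousWithinAt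
  refine ContinuousOn.div (by fun_prop) (by fun_prop) fun y hy => pow_ne_zero 3 ?_
  linarith [ha k, mem_Ioi.1 hy]

theorem tsum_neg_div_add_cube_neg (h0 : 0 < a 0) (ha : ∀ k, a 0 ≤ a k)
    (hs : Summable fun k => (a k)⁻¹) {x : ℝ} (hx : -a 0 < x) :
    ∑' k, -(2 * a k) / (a k + x) ^ 3 < 0 := by
  have hneg : ∀ k, -(2 * a k) / (a k + x) ^ 3 < 0 := fun k => by
    have hk := h0.trans_le (ha k)
    have : 0 < a k + x := by linarith [ha k]
    exact div_neg_of_neg_of_pos (by linarith) (by positivity)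
  simpa using (summable_neg_div_add_cube h0 ha hs hx).tsum_lt_tsum (i := 0)
    (fun k => (hneg k).le) (hneg 0) summable_zero

theorem contDiffOn_tsum_div_add_sq (h0 : 0 < a 0) (ha : ∀ k, a 0 ≤ a k)
    (hs : Summable fun k => (a k)⁻¹) :
    ContDiffOn ℝ 1 (fun x => ∑' k, a k / (a k + x) ^ 2) (Ioi (-a 0)) := by
  rw [show (1 : WithTop ℕ∞) = 0 + 1 by simp, contDiffOn_succ_iff_deriv_of_isOpen isOpen_Ioi]
  refine ⟨fun x hx => (hasDerivAt_tsum_div_add_sq h0 ha hs hx).differentiableAt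
    |>.differentiableWithinAt, by simp, ?_⟩
  rw [contDiffOn_zero]
  exact (continuousOn_tsum_neg_div_add_cube h0 ha hs).congr
    fun x hx => (hasDerivAt_tsum_div_add_sq h0 ha hs hx).deriv

theorem strictAntiOn_tsum_div_add_sq (h0 : 0 < a 0) (ha : ∀ k, a 0 ≤ a k)
    (hs : Summable fun k => (a k)⁻¹) :
    StrictAntiOn (fun x => ∑' k, a k / (a k + x) ^ 2) (Ioi (-a 0)) := by
  refine strictAntiOn_of_deriv_neg (convex_Ioi _) (contDiffOn_tsum_div_add_sq h0 ha hs).continuousOn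
    fun x hx => ?_
  rw [interior_Ioi] at hx
  rw [(hasDerivAt_tsum_div_add_sq h0 ha hs hx).deriv]
  exact tsum_neg_div_add_cube_neg h0 ha hs hx

theorem tendsto_tsum_div_add_sq_atTop (h0 : 0 < a 0) (ha : ∀ k, a 0 ≤ a k)
    (hs : Summable fun k => (a k)⁻¹) :
    Tendsto (fun x => ∑' k, a k / (a k + x) ^ 2) atTop (𝓝 0) := by
  have := tendsto_tsum_of_dominated_convergence (𝓕 := atTop)
    (f := fun x k => a k / (a k + x) ^ 2) (g := fun _ => (0 : ℝ)) (hs.mul_left _)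
    (fun k => tendsto_const_nhds.div_atTop
      ((tendsto_pow_atTop two_ne_zero).comp (tendsto_atTop_add_const_left _ (a k) tendsto_id)))
    (by
      filter_upwards [eventually_gt_atTop (-0)] with x hx
      exact norm_div_add_sq_le h0 ha le_rfl h0 hx)
  simpa using this

theorem exists_tsum_div_add_sq_eq (h0 : 0 < a 0) (ha : ∀ k, a 0 ≤ a k)
    (hs : Summable fun k => (a k)⁻¹) {y : ℝ} (hy : 0 < y) :
    ∃ x ∈ Ioi (-a 0), ∑' k, a k / (a k + x) ^ 2 = y := by
  obtain ⟨x₁, hx₁, hy₁⟩ := ((tendsto_tsum_div_add_sq_atTop h0 ha hs).eventually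
    (gt_mem_nhds hy) |>.and (eventually_gt_atTop 0)).exists
  set x₀ := -a 0 + √(a 0 / y)
  have hx₀ : -a 0 < x₀ := by
    have : 0 < √(a 0 / y) := Real.sqrt_pos.2 (div_pos h0 hy)
    simp only [x₀]; linarith
  have hy₀ : y ≤ ∑' k, a k / (a k + x₀) ^ 2 := by
    refine le_trans (le_of_eq ?_) ((summable_div_add_sq h0 ha hs hx₀).le_tsum 0 fun k _ => ?_)
    · rw [show a 0 + x₀ = √(a 0 / y) by simp [x₀], Real.sq_sqrt (by positivity)]
      field_simp
    · exact div_nonneg (h0.le.trans (ha k)) (sq_nonneg _)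
  exact isPreconnected_Ioi.intermediate_value (show x₁ ∈ Ioi (-a 0) by
    simp only [mem_Ioi]; linarith) hx₀ (contDiffOn_tsum_div_add_sq h0 ha hs).continuousOn
    ⟨hx₁.le, hy₀⟩

end PoleSeries

theorem hasSum_tan_series {x : ℂ} (hx : ∀ n : ℤ, 1 / 2 - x ≠ n)
    (hs : Summable fun n : ℕ => 2 * x / (((n : ℂ) + 1 / 2) ^ 2 - x ^ 2)) :
    HasSum (fun n : ℕ => 2 * x / (((n : ℂ) + 1 / 2) ^ 2 - x ^ 2)) (π * Complex.tan (π * x)) := by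
  have hmem : 1 / 2 - x ∈ Complex.integerComplement := by
    rintro ⟨n, hn⟩
    exact hx n hn.symm
  rw [hs.hasSum_iff_tendsto_nat]
  have h1 := tendsto_logDeriv_euler_cot_sub hmem
  have hcot : Complex.cot (π * (1 / 2 - x)) = Complex.tan (π * x) := by
    rw [Complex.cot_eq_cos_div_sin, Complex.tan_eq_sin_div_cos,
      show (π : ℂ) * (1 / 2 - x) = π / 2 - π * x by ring,
      Complex.cos_pi_div_two_sub, Complex.sin_pi_div_two_sub]
  rw [hcot] at h1
  have hm (n : ℕ) : (n : ℂ) + 1 / 2 - x ≠ 0 := fun h => hx (-n) (by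
    push_cast; linear_combination h)
  have hp (n : ℕ) : (n : ℂ) + 1 / 2 + x ≠ 0 := fun h => hx (n + 1) (by
    push_cast; linear_combination -h)
  have hlim : Tendsto (fun N : ℕ => ((N : ℂ) + 1 / 2 - x)⁻¹) atTop (𝓝 0) := by
    have := tendsto_inv₀_cobounded.comp
      ((tendsto_add_const_cobounded (1 / 2 - x)).comp (tendsto_natCast_atTop_cobounded (α := ℂ)))
    simpa [Function.comp_def, add_sub_assoc] using this
  have key (N : ℕ) : ∑ n ∈ Finset.range N, 2 * x / (((n : ℂ) + 1 / 2) ^ 2 - x ^ 2) =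
      ∑ n ∈ Finset.range N, cotTerm (1 / 2 - x) n + (1 / (1 / 2 - x))
        - ((N : ℂ) + 1 / 2 - x)⁻¹ := by
    induction N with
    | zero => simp
    | succ N ih =>
      rw [Finset.sum_range_succ, Finset.sum_range_succ, ih, cotTerm]
      have e1 : ((N : ℂ) + 1 / 2) ^ 2 - x ^ 2 = (N + 1 / 2 - x) * (N + 1 / 2 + x) := by ring
      have e2 : 1 / 2 - x - ((N : ℂ) + 1) = -(N + 1 / 2 + x) := by ring
      have e3 : 1 / 2 - x + ((N : ℂ) + 1) = (N + 1 : ℕ) + 1 / 2 - x := by push_cast; ring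
      have hsplit : 2 * x / ((N + 1 / 2 - x) * (N + 1 / 2 + x)) =
          ((N : ℂ) + 1 / 2 - x)⁻¹ - (N + 1 / 2 + x)⁻¹ := by
        rw [inv_sub_inv (hm N) (hp N)]
        ring
      rw [e1, e2, e3, hsplit]
      simp only [one_div, inv_neg]
      ring
  simp_rw [key]
  simpa using (h1.add_const (1 / (1 / 2 - x))).sub hlim

/-- The negated poles of `alphaStar b`. -/
noncomputable def alphaStarPole (b : ℝ) (k : ℕ) : ℝ := (2 * k + 1) ^ 2 * π ^ 2 / (8 * b ^ 2)

theorem alphaStarPole_zero (b : ℝ) : alphaStarPole b 0 = π ^ 2 / (8 * b ^ 2) := by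
  simp [alphaStarPole]

theorem alphaStarPole_zero_pos {b : ℝ} (hb : 0 < b) : 0 < alphaStarPole b 0 := by
  rw [alphaStarPole_zero]; positivity

theorem alphaStarPole_zero_le (b : ℝ) (k : ℕ) : alphaStarPole b 0 ≤ alphaStarPole b k := by
  unfold alphaStarPole
  gcongr
  simp

theorem summable_inv_alphaStarPole (b : ℝ) : Summable fun k => (alphaStarPole b k)⁻¹ := by
  have h : Summable fun n : ℕ => 1 / ((2 * n + 1 : ℕ) : ℝ) ^ 2 :=
    (Real.summable_one_div_nat_pow.2 one_lt_two).comp_injective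
      (i := fun n : ℕ => 2 * n + 1) fun m n h => by simpa using h
  refine (h.mul_left (8 * b ^ 2 / π ^ 2)).congr fun n => ?_
  rw [alphaStarPole]
  push_cast
  field_simp

theorem summable_inv_alphaStarPole_add {b : ℝ} (hb : 0 < b) {lam : ℝ}
    (hlam : -alphaStarPole b 0 < lam) : Summable fun k => (alphaStarPole b k + lam)⁻¹ := by
  have h0 := alphaStarPole_zero_pos hb
  have ha := alphaStarPole_zero_le b
  obtain ⟨r, hr0, hr, hx⟩ := exists_lt_of_neg_lt h0 hlam
  have hc : 0 < 1 - r / alphaStarPole b 0 := by rw [sub_pos, div_lt_one h0]; exact hr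
  refine .of_nonneg_of_le (fun k => ?_) (fun k => ?_)
    ((summable_inv_alphaStarPole b).mul_left (1 - r / alphaStarPole b 0)⁻¹)
  · exact inv_nonneg.2 (by linarith [ha k])
  · rw [← mul_inv]
    exact inv_anti₀ (mul_pos hc (h0.trans_le (ha k))) (one_sub_div_mul_le_add h0 ha hr0 hx k)

theorem neg_mul_tan_eq_tsum {b : ℝ} (hb : 0 < b) {lam : ℝ} (hlam : -alphaStarPole b 0 < lam)
    {w : ℂ} (hw : w ^ 2 = -(2 * lam : ℝ)) :
    -(w * Complex.tan (b * w)) =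
      ((2 / b * ∑' k, lam / (alphaStarPole b k + lam) : ℝ) : ℂ) := by
  have hbC : (b : ℂ) ≠ 0 := by exact_mod_cast hb.ne'
  have hpi : (π : ℂ) ≠ 0 := by exact_mod_cast Real.pi_ne_zero
  set x : ℂ := b * w / π
  have hx2 : x ^ 2 = ((-(2 * b ^ 2 * lam / π ^ 2) : ℝ) : ℂ) := by
    simp only [x, div_pow, mul_pow, hw]
    push_cast
    ring
  have hne (k : ℕ) : ((alphaStarPole b k + lam : ℝ) : ℂ) ≠ 0 := by
    have := alphaStarPole_zero_le b k
    exact_mod_cast (show (0 : ℝ) < alphaStarPole b k + lam by linarith).ne'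
  have hden (k : ℕ) : ((k : ℂ) + 1 / 2) ^ 2 - x ^ 2 =
      2 * b ^ 2 / π ^ 2 * ((alphaStarPole b k + lam : ℝ) : ℂ) := by
    rw [hx2, alphaStarPole]
    push_cast
    field_simp
    ring
  have hterm (k : ℕ) : 2 * x / (((k : ℂ) + 1 / 2) ^ 2 - x ^ 2) =
      π * w / b * (((alphaStarPole b k + lam)⁻¹ : ℝ) : ℂ) := by
    have := hne k
    rw [hden, Complex.ofReal_inv]
    simp only [x]
    field_simp
  have hsR := summable_inv_alphaStarPole_add hb hlam
  have hsum : Summable fun n : ℕ => 2 * x / (((n : ℂ) + 1 / 2) ^ 2 - x ^ 2) := by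
    simp_rw [hterm]
    exact (Complex.summable_ofReal.2 hsR).mul_left _
  have hint : ∀ n : ℤ, 1 / 2 - x ≠ n := by
    intro n hn
    have hxn : x = ((1 / 2 - n : ℝ) : ℂ) := by push_cast; linear_combination -hn
    rw [hxn] at hx2
    have h2 : (1 / 2 - n : ℝ) ^ 2 = -(2 * b ^ 2 * lam / π ^ 2) := by exact_mod_cast hx2
    have h3 : -(2 * b ^ 2 * lam / π ^ 2) < 1 / 4 := by
      rw [alphaStarPole_zero, neg_lt, lt_div_iff₀ (by positivity)] at hlam
      rw [neg_lt, lt_div_iff₀ (by positivity)]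
      linarith
    have h4 : (0 : ℝ) ≤ n * (n - 1) := by
      have : 0 ≤ n * (n - 1) := by
        rcases le_or_gt n 0 with h | h <;> nlinarith
      exact_mod_cast this
    nlinarith
  have h := (hasSum_tan_series hint hsum).tsum_eq
  simp_rw [hterm] at h
  rw [tsum_mul_left, ← Complex.ofReal_tsum, show (π : ℂ) * x = b * w by
    simp only [x]; field_simp] at h
  have hb' : (∑' k, lam / (alphaStarPole b k + lam)) =
      lam * ∑' k, (alphaStarPole b k + lam)⁻¹ := by
    rw [← tsum_mul_left]; rfl
  have h' : Complex.tan (b * w) = w / b * ((∑' k, (alphaStarPole b k + lam)⁻¹ : ℝ) : ℂ) := by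
    apply mul_left_cancel₀ hpi
    rw [← h]; ring
  rw [h', hb']
  push_cast at hw ⊢
  linear_combination (-(∑' k, ((alphaStarPole b k : ℂ) + lam)⁻¹) / b) * hw

theorem alphaStar_eq_tsum {b : ℝ} (hb : 0 < b) {lam : ℝ} (hlam : -alphaStarPole b 0 < lam) :
    alphaStar b lam = 2 / b * ∑' k, lam / (alphaStarPole b k + lam) := by
  rw [← Complex.ofReal_inj]
  unfold alphaStar
  split_ifs with h
  · rw [← neg_mul_tan_eq_tsum hb hlam (w := √(2 * lam) * Complex.I)]
    · rw [← mul_assoc, Complex.tan_mul_I]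
      push_cast
      linear_combination ((√(2 * lam) : ℂ) * Complex.tanh (b * √(2 * lam))) * Complex.I_sq
    · rw [mul_pow, Complex.I_sq, ← Complex.ofReal_pow, Real.sq_sqrt (by linarith)]
      push_cast
      ring
  · rw [← neg_mul_tan_eq_tsum hb hlam (w := √(-(2 * lam)))]
    · push_cast
      ring
    · rw [← Complex.ofReal_pow, Real.sq_sqrt (by linarith)]
      push_cast
      ring

theorem deriv_alphaStar {b : ℝ} (hb : 0 < b) {lam : ℝ} (hlam : -alphaStarPole b 0 < lam) :
    deriv (alphaStar b) lam =
      2 / b * ∑' k, alphaStarPole b k / (alphaStarPole b k + lam) ^ 2 := by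
  have h := (hasDerivAt_tsum_div_add (alphaStarPole_zero_pos hb) (alphaStarPole_zero_le b)
    (summable_inv_alphaStarPole b) hlam).const_mul (2 / b)
  refine (h.congr_of_eventuallyEq ?_).deriv
  filter_upwards [Ioi_mem_nhds hlam] with y hy using alphaStar_eq_tsum hb hy

/-- For `b > 0` and every `x > 0` there is a unique `λ*(x) ∈ (-π²/(8b²), ∞)` with
`(α*)'(λ*(x)) = 1/x`, and the map `x ↦ λ*(x)` is continuously differentiable on
`(0, ∞)`. -/
theorem lambdaStar_exists_unique_C1 (b : ℝ) (hb : 0 < b) :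
    (∀ x : ℝ, 0 < x → ∃! lam : ℝ, lam ∈ Set.Ioi (-(π ^ 2 / (8 * b ^ 2))) ∧
      deriv (alphaStar b) lam = 1 / x) ∧
    ∃ lamStar : ℝ → ℝ,
      (∀ x : ℝ, 0 < x → lamStar x ∈ Set.Ioi (-(π ^ 2 / (8 * b ^ 2))) ∧
        deriv (alphaStar b) (lamStar x) = 1 / x) ∧
      ContDiffOn ℝ 1 lamStar (Set.Ioi 0) := by
  have h0 := alphaStarPole_zero_pos hb
  have ha := alphaStarPole_zero_le b
  have hs := summable_inv_alphaStarPole b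
  have hanti := strictAntiOn_tsum_div_add_sq h0 ha hs
  have hex (x : ℝ) (hx : 0 < x) : ∃ lam ∈ Ioi (-alphaStarPole b 0),
      ∑' k, alphaStarPole b k / (alphaStarPole b k + lam) ^ 2 = b / (2 * x) :=
    exists_tsum_div_add_sq_eq h0 ha hs (by positivity)
  have hiff {x lam : ℝ} (hx : 0 < x) (hlam : lam ∈ Ioi (-alphaStarPole b 0)) :
      deriv (alphaStar b) lam = 1 / x ↔
        ∑' k, alphaStarPole b k / (alphaStarPole b k + lam) ^ 2 = b / (2 * x) := by
    rw [deriv_alphaStar hb hlam, div_mul_eq_mul_div, div_eq_iff hb.ne', eq_div_iff (by positivity)]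
    field_simp
  rw [← alphaStarPole_zero]
  choose! l hl hl' using hex
  refine ⟨fun x hx => ⟨l x, ⟨hl x hx, (hiff hx (hl x hx)).2 (hl' x hx)⟩, fun y ⟨hy, hy'⟩ => ?_⟩,
    l, fun x hx => ⟨hl x hx, (hiff hx (hl x hx)).2 (hl' x hx)⟩, ?_⟩
  · exact hanti.injOn hy (hl x hx) (((hiff hx hy).1 hy').trans (hl' x hx).symm)
  · have hC : ContDiffOn ℝ 1 (fun y => l (b / (2 * y))) (Ioi 0) := by
      refine contDiffOn_of_rightInvOn isOpen_Ioi hanti.injOn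
        (contDiffOn_tsum_div_add_sq h0 ha hs) (fun u hu => ?_) (fun y hy => ?_) isOpen_Ioi
        fun y hy => ?_
      · rw [(hasDerivAt_tsum_div_add_sq h0 ha hs hu).deriv]
        exact (tsum_neg_div_add_cube_neg h0 ha hs hu).ne
      · have hy : 0 < y := hy
        exact hl _ (by positivity)
      · have hy : 0 < y := hy
        refine (hl' _ (by positivity)).trans ?_
        field_simp
    refine (hC.comp (f := fun x => b / (2 * x)) (s := Ioi 0) ?_ fun x hx => ?_).congr fun x hx => ?_
    · exact contDiffOn_const.div (by fun_prop) fun x hx => by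
        have hx : 0 < x := hx
        positivity
    · have hx : 0 < x := hx
      exact div_pos hb (by positivity)
    · have hx : 0 < x := hx
      simp only [Function.comp]
      congr 1
      field_simp
end

section
/- Let $b > 0$, let $\alpha^*$ be the smooth extension to $(-\tfrac{\pi^2}{8b^2},\infty)$ of $\lambda \mapsto \sqrt{2\lambda}\,\tanh(b\sqrt{2\lambda})$ (equal to $-\sqrt{-2\lambda}\,\tan(b\sqrt{-2\lambda})$ for negative arguments), let $V := (\alpha^*)^{-1}$, and define the Legendre transform $V^*(x) := \sup_{\alpha \in \mathbb{R}} (\alpha x - V(\alpha))$ for $x \ge 0$. Then for every $x > 0$, $V^*(x) = x\,\alpha^*(\lambda^*(x)) - \lambda^*(x)$, where $\lambda^*(x)$ is the unique solution in $(-\tfrac{\pi^2}{8b^2},\infty)$ of $(\alpha^*)'(\lambda) = 1/x$; in particular the supremum is finite and is attained at $\alpha = \alpha^*(\lambda^*(x))$. -/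
open scoped Real

namespace Real

theorem hasDerivAt_tanh (y : ℝ) : HasDerivAt tanh (1 - tanh y ^ 2) y := by
  have h := (hasDerivAt_sinh y).fun_div (hasDerivAt_cosh y) (cosh_pos y).ne'
  have hc := (cosh_pos y).ne'
  have he : (fun z => sinh z / cosh z) = tanh := funext fun z => (tanh_eq_sinh_div_cosh z).symm
  rw [he] at h
  refine h.congr_deriv ?_
  rw [tanh_eq_sinh_div_cosh]
  field_simp

theorem strictMono_tanh : StrictMono tanh :=
  strictMono_of_hasDerivAt_pos hasDerivAt_tanh fun y => by
    have := tanh_sq_lt_one y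
    linarith

theorem tanh_nonneg {y : ℝ} (hy : 0 ≤ y) : 0 ≤ tanh y := by
  simpa using strictMono_tanh.monotone hy

theorem concaveOn_tanh : ConcaveOn ℝ (Set.Ici 0) tanh := by
  have hd : deriv tanh = fun y => 1 - tanh y ^ 2 := funext fun y => (hasDerivAt_tanh y).deriv
  refine AntitoneOn.concaveOn_of_deriv (convex_Ici 0)
    (fun y _ => (hasDerivAt_tanh y).continuousAt.continuousWithinAt)
    (fun y _ => (hasDerivAt_tanh y).differentiableAt.differentiableWithinAt) ?_
  rw [interior_Ici, hd]
  intro y hy z _ hyz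
  have := pow_le_pow_left₀ (tanh_nonneg (le_of_lt hy)) (strictMono_tanh.monotone hyz) 2
  simp only
  linarith

theorem hasDerivAt_tan' {y : ℝ} (hy : y ∈ Set.Ico 0 (π / 2)) :
    HasDerivAt tan (1 + tan y ^ 2) y := by
  have hc : cos y ≠ 0 := (cos_pos_of_mem_Ioo ⟨by linarith [hy.1, pi_pos], hy.2⟩).ne'
  refine (hasDerivAt_tan hc).congr_deriv ?_
  rw [one_div, inv_eq_iff_eq_inv, inv_one_add_tan_sq hc]

theorem convexOn_tan : ConvexOn ℝ (Set.Ico 0 (π / 2)) tan := by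
  refine MonotoneOn.convexOn_of_deriv (convex_Ico 0 _)
    (fun y hy => (hasDerivAt_tan' hy).continuousAt.continuousWithinAt)
    (fun y hy => (hasDerivAt_tan' (interior_subset hy)).differentiableAt.differentiableWithinAt) ?_
  intro y hy z hz hyz
  have hy := interior_subset hy
  have hz := interior_subset hz
  rw [(hasDerivAt_tan' hy).deriv, (hasDerivAt_tan' hz).deriv]
  have hm : tan y ≤ tan z := strictMonoOn_tan.monotoneOn
    ⟨by linarith [hy.1, pi_pos], hy.2⟩ ⟨by linarith [hz.1, pi_pos], hz.2⟩ hyz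
  have := pow_le_pow_left₀ (tan_nonneg_of_nonneg_of_le_pi_div_two hy.1 hy.2.le) hm 2
  linarith

theorem deriv_tanh_zero : deriv tanh 0 = 1 := by
  simp [(hasDerivAt_tanh 0).deriv]

theorem deriv_tan_zero : deriv tan 0 = 1 := by
  simp [(hasDerivAt_tan' ⟨le_rfl, by positivity⟩).deriv]

theorem antitoneOn_dslope_tanh : AntitoneOn (dslope tanh 0) (Set.Ici 0) := by
  intro y (hy : 0 ≤ y) z (hz : 0 ≤ z) hyz
  rcases hyz.eq_or_lt with rfl | hyz
  · rfl
  have hz0 : 0 < z := hy.trans_lt hyz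
  rw [dslope_of_ne _ hz0.ne']
  rcases hy.eq_or_lt with rfl | hy0
  · rw [dslope_same, deriv_tanh_zero]
    have := concaveOn_tanh.slope_le_of_hasDerivAt (x := 0) Set.self_mem_Ici hz hz0
      (hasDerivAt_tanh 0)
    simpa using this
  · rw [dslope_of_ne _ hy0.ne']
    exact concaveOn_tanh.slope_anti Set.self_mem_Ici ⟨hy, hy0.ne'⟩ ⟨hz, hz0.ne'⟩ hyz.le

theorem monotoneOn_dslope_tan : MonotoneOn (dslope tan 0) (Set.Ico 0 (π / 2)) := by
  have h0 : (0 : ℝ) ∈ Set.Ico 0 (π / 2) := ⟨le_rfl, by positivity⟩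
  intro y hy z hz hyz
  rcases hyz.eq_or_lt with rfl | hyz
  · rfl
  have hz0 : 0 < z := hy.1.trans_lt hyz
  rw [dslope_of_ne _ hz0.ne']
  rcases hy.1.eq_or_lt with rfl | hy0
  · rw [dslope_same, deriv_tan_zero]
    have := convexOn_tan.le_slope_of_hasDerivAt h0 hz hz0 (hasDerivAt_tan' h0)
    simpa using this
  · rw [dslope_of_ne _ hy0.ne']
    exact convexOn_tan.slope_mono h0 ⟨hy, hy0.ne'⟩ ⟨hz, hz0.ne'⟩ hyz.le

end Real

section alphaStar

open Real Filter Topology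

/-- The derivative of `alphaStar b`. -/
noncomputable def alphaStarDeriv (b lam : ℝ) : ℝ :=
  if 0 ≤ lam then
    b * (dslope tanh 0 (b * √(2 * lam)) + (1 - tanh (b * √(2 * lam)) ^ 2))
  else b * (dslope tan 0 (b * √(-(2 * lam))) + (1 + tan (b * √(-(2 * lam))) ^ 2))

variable {b : ℝ}

theorem mul_sqrt_mem_Ico (hb : 0 < b) {lam : ℝ} (hl : -(π ^ 2 / (8 * b ^ 2)) < lam) :
    b * √(-(2 * lam)) ∈ Set.Ico 0 (π / 2) := by
  refine ⟨by positivity, ?_⟩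
  rw [← lt_div_iff₀' hb, Real.sqrt_lt' (by positivity)]
  have : (π / 2 / b) ^ 2 = 2 * (π ^ 2 / (8 * b ^ 2)) := by field_simp; norm_num
  linarith

theorem hasDerivAt_sqrt_mul_comp {f : ℝ → ℝ} {f' c lam : ℝ} (hb : 0 < b) (hl : 0 < c * lam)
    (hf : HasDerivAt f f' (b * √(c * lam))) :
    HasDerivAt (fun t => √(c * t) * f (b * √(c * t)))
      (c / 2 * (b * (slope f 0 (b * √(c * lam)) + f 0 / (b * √(c * lam)) + f'))) lam := by
  have hs : HasDerivAt (fun t => √(c * t)) (c / (2 * √(c * lam))) lam := by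
    have := ((hasDerivAt_id' lam).const_mul c).sqrt hl.ne'
    simpa using this
  have h := hs.fun_mul (hf.comp lam (hs.const_mul b))
  have hp : 0 < √(c * lam) := Real.sqrt_pos.2 hl
  refine h.congr_deriv ?_
  simp only [slope_def_field, Function.comp]
  field_simp
  ring

theorem tendsto_dslope_sqrt {f : ℝ → ℝ} (hf : DifferentiableAt ℝ f 0) (h1 : deriv f 0 = 1)
    (c : ℝ) (s : Set ℝ) :
    Tendsto (fun t => 2 * b * dslope f 0 (b * √(c * t))) (𝓝[s] 0) (𝓝 (2 * b)) := by
  have hc : ContinuousAt (fun t => 2 * b * dslope f 0 (b * √(c * t))) 0 := by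
    refine continuousAt_const.mul (ContinuousAt.comp (f := fun t => b * √(c * t)) ?_ (by fun_prop))
    rw [mul_zero, Real.sqrt_zero, mul_zero]
    exact continuousAt_dslope_same.2 hf
  have := hc.tendsto
  simp only [mul_zero, Real.sqrt_zero, dslope_same, h1, mul_one] at this
  exact this.mono_left nhdsWithin_le_nhds

theorem hasDerivAt_alphaStar_zero (hb : 0 < b) : HasDerivAt (alphaStar b) (2 * b) 0 := by
  rw [hasDerivAt_iff_tendsto_slope_left_right]
  constructor
  · refine (tendsto_dslope_sqrt (hasDerivAt_tan' ⟨le_rfl, by positivity⟩).differentiableAt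
      deriv_tan_zero (-2) _).congr' ?_
    filter_upwards [self_mem_nhdsWithin] with t (ht : t < 0)
    have hp : 0 < √(-(2 * t)) := Real.sqrt_pos.2 (by linarith)
    have hsq : √(-(2 * t)) ^ 2 = -(2 * t) := Real.sq_sqrt (by linarith)
    rw [neg_mul, dslope_of_ne _ (by positivity)]
    simp only [slope_def_field, alphaStar, not_le.2 ht, if_false, le_refl, if_true]
    simp only [mul_zero, Real.sqrt_zero, Real.tan_zero, Real.tanh_zero, sub_zero]
    have := ht.ne
    field_simp
    rw [hsq]
    ring
  · refine (tendsto_dslope_sqrt (hasDerivAt_tanh 0).differentiableAt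
      deriv_tanh_zero 2 _).congr' ?_
    filter_upwards [self_mem_nhdsWithin] with t (ht : 0 < t)
    have hp : 0 < √(2 * t) := Real.sqrt_pos.2 (by linarith)
    have hsq : √(2 * t) ^ 2 = 2 * t := Real.sq_sqrt (by linarith)
    rw [dslope_of_ne _ (by positivity)]
    simp only [slope_def_field, alphaStar, ht.le, le_refl, if_true]
    simp only [mul_zero, Real.sqrt_zero, Real.tanh_zero, sub_zero]
    field_simp
    rw [hsq]

theorem hasDerivAt_alphaStar (hb : 0 < b) {lam : ℝ} (hl : -(π ^ 2 / (8 * b ^ 2)) < lam) :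
    HasDerivAt (alphaStar b) (alphaStarDeriv b lam) lam := by
  rcases lt_trichotomy lam 0 with h | rfl | h
  · have hp : 0 < √(-(2 * lam)) := Real.sqrt_pos.2 (by linarith)
    have key := (hasDerivAt_sqrt_mul_comp (c := -2) (lam := lam) hb (by linarith)
      (by simpa using hasDerivAt_tan' (mul_sqrt_mem_Ico hb hl))).fun_neg
    refine (key.congr_of_eventuallyEq ?_).congr_deriv ?_
    · filter_upwards [Iio_mem_nhds h] with t (ht : t < 0)
      simp [alphaStar, not_le.2 ht]
    · simp only [alphaStarDeriv, not_le.2 h, if_false, neg_mul]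
      rw [dslope_of_ne _ (by positivity)]
      simp
  · refine (hasDerivAt_alphaStar_zero hb).congr_deriv ?_
    simp [alphaStarDeriv, deriv_tanh_zero]
    ring
  · have hp : 0 < √(2 * lam) := Real.sqrt_pos.2 (by linarith)
    have key := hasDerivAt_sqrt_mul_comp (c := 2) hb (by linarith)
      (hasDerivAt_tanh (b * √(2 * lam)))
    refine (key.congr_of_eventuallyEq ?_).congr_deriv ?_
    · filter_upwards [Ioi_mem_nhds h] with t (ht : 0 < t)
      simp [alphaStar, ht.le]
    · simp only [alphaStarDeriv, h.le, if_true]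
      rw [dslope_of_ne _ (by positivity)]
      simp

theorem alphaStarDeriv_zero : alphaStarDeriv b 0 = b * (1 + 1) := by
  simp [alphaStarDeriv, deriv_tanh_zero]

theorem strictAntiOn_alphaStarDeriv_Ici (hb : 0 < b) :
    StrictAntiOn (alphaStarDeriv b) (Set.Ici 0) := by
  intro l (hl : 0 ≤ l) m (hm : 0 ≤ m) hlm
  have hy : b * √(2 * l) < b * √(2 * m) :=
    mul_lt_mul_of_pos_left (Real.sqrt_lt_sqrt (by positivity) (by linarith)) hb
  have hy0 : 0 ≤ b * √(2 * l) := by positivity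
  simp only [alphaStarDeriv, hl, hm, if_true]
  have h1 := antitoneOn_dslope_tanh hy0 (hy0.trans hy.le) hy.le
  have h2 := pow_lt_pow_left₀ (strictMono_tanh hy) (tanh_nonneg hy0) two_ne_zero
  exact mul_lt_mul_of_pos_left (by linarith) hb

theorem strictAntiOn_alphaStarDeriv_Ioc (hb : 0 < b) :
    StrictAntiOn (alphaStarDeriv b) (Set.Ioc (-(π ^ 2 / (8 * b ^ 2))) 0) := by
  have hform : ∀ l ≤ 0, alphaStarDeriv b l =
      b * (dslope tan 0 (b * √(-(2 * l))) + (1 + tan (b * √(-(2 * l))) ^ 2)) := by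
    intro l hl
    rcases hl.eq_or_lt with rfl | hl
    · simp [alphaStarDeriv_zero]
    · simp [alphaStarDeriv, not_le.2 hl]
  intro l hl m hm hlm
  have hyz : b * √(-(2 * m)) < b * √(-(2 * l)) :=
    mul_lt_mul_of_pos_left (Real.sqrt_lt_sqrt (by linarith [hm.2]) (by linarith)) hb
  have hy := mul_sqrt_mem_Ico hb hm.1
  have hz := mul_sqrt_mem_Ico hb hl.1
  rw [hform l hl.2, hform m hm.2]
  have h1 := monotoneOn_dslope_tan hy hz hyz.le
  have h2 := pow_lt_pow_left₀ (tan_lt_tan_of_nonneg_of_lt_pi_div_two hy.1 hz.2 hyz)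
    (tan_nonneg_of_nonneg_of_le_pi_div_two hy.1 hy.2.le) two_ne_zero
  exact mul_lt_mul_of_pos_left (by linarith) hb

theorem strictAntiOn_alphaStarDeriv (hb : 0 < b) :
    StrictAntiOn (alphaStarDeriv b) (Set.Ioi (-(π ^ 2 / (8 * b ^ 2)))) := by
  have h0 : -(π ^ 2 / (8 * b ^ 2)) < 0 := neg_neg_of_pos (by positivity)
  rw [← Set.Ioc_union_Ici_eq_Ioi h0]
  exact (strictAntiOn_alphaStarDeriv_Ioc hb).union (strictAntiOn_alphaStarDeriv_Ici hb)
    (isGreatest_Ioc h0) isLeast_Ici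

theorem alphaStarDeriv_pos_of_nonneg (hb : 0 < b) {lam : ℝ} (hl : 0 ≤ lam) : 0 < alphaStarDeriv b lam := by
  simp only [alphaStarDeriv, hl, if_true]
  have h1 : 0 ≤ dslope tanh 0 (b * √(2 * lam)) := by
    have hy : 0 ≤ b * √(2 * lam) := by positivity
    rcases hy.eq_or_lt with h | h
    · simp only [← h, dslope_same, deriv_tanh_zero, zero_le_one]
    · rw [dslope_of_ne _ h.ne', slope_def_field, tanh_zero, sub_zero, sub_zero]
      exact div_nonneg (tanh_nonneg hy) hy
  have h2 := tanh_sq_lt_one (b * √(2 * lam))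
  exact mul_pos hb (by linarith)

theorem strictMonoOn_alphaStar (hb : 0 < b) :
    StrictMonoOn (alphaStar b) (Set.Ioi (-(π ^ 2 / (8 * b ^ 2)))) := by
  refine strictMonoOn_of_deriv_pos (convex_Ioi _)
    (fun l hl => (hasDerivAt_alphaStar hb hl).continuousAt.continuousWithinAt) fun l hl => ?_
  rw [interior_Ioi] at hl
  rw [(hasDerivAt_alphaStar hb hl).deriv]
  rcases le_total 0 l with h | h
  · exact alphaStarDeriv_pos_of_nonneg hb h
  · have h0 : -(π ^ 2 / (8 * b ^ 2)) < 0 := neg_neg_of_pos (by positivity)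
    exact (alphaStarDeriv_pos_of_nonneg hb le_rfl).trans_le
      ((strictAntiOn_alphaStarDeriv hb).antitoneOn hl h0 h)

end alphaStar

/-- For `b > 0`, `V = (α*)⁻¹` and `x > 0`, the Legendre transform
`V*(x) = sup_α (α x - V(α))` equals `x α*(λ*(x)) - λ*(x)`, where `λ*(x)` is the
unique solution in `(-π²/(8b²), ∞)` of `(α*)'(λ) = 1/x`; the supremum is finite
and attained at `α = α*(λ*(x))`. -/
theorem legendre_transform_of_V_formula (b : ℝ) (hb : 0 < b)
    (V : ℝ → ℝ)
    (hV : ∀ α : ℝ, V α ∈ Set.Ioi (-(π ^ 2 / (8 * b ^ 2))) ∧ alphaStar b (V α) = α)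
    (x : ℝ) (hx : 0 < x)
    (lamStar : ℝ) (hls : lamStar ∈ Set.Ioi (-(π ^ 2 / (8 * b ^ 2))))
    (hls' : deriv (alphaStar b) lamStar = 1 / x) :
    (∀ lam ∈ Set.Ioi (-(π ^ 2 / (8 * b ^ 2))), deriv (alphaStar b) lam = 1 / x →
      lam = lamStar) ∧
    IsGreatest (Set.range fun α : ℝ => α * x - V α) (x * alphaStar b lamStar - lamStar) ∧
    alphaStar b lamStar * x - V (alphaStar b lamStar) = x * alphaStar b lamStar - lamStar := by
  have hd : ∀ l ∈ Set.Ioi (-(π ^ 2 / (8 * b ^ 2))), deriv (alphaStar b) l = alphaStarDeriv b l :=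
    fun l hl => (hasDerivAt_alphaStar hb hl).deriv
  have hcont : ContinuousOn (alphaStar b) (Set.Ioi (-(π ^ 2 / (8 * b ^ 2)))) :=
    fun l hl => (hasDerivAt_alphaStar hb hl).continuousAt.continuousWithinAt
  have hanti := strictAntiOn_alphaStarDeriv hb
  have hconc : ConcaveOn ℝ (Set.Ioi (-(π ^ 2 / (8 * b ^ 2)))) (alphaStar b) :=
    (StrictAntiOn.strictConcaveOn_of_deriv (convex_Ioi _) hcont
      (by rw [interior_Ioi]; exact hanti.congr fun l hl => (hd l hl).symm)).concaveOn
  have hmono := strictMonoOn_alphaStar hb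
  have hVinv : V (alphaStar b lamStar) = lamStar :=
    hmono.injOn (hV _).1 hls (hV _).2
  have hD : HasDerivAt (alphaStar b) (1 / x) lamStar :=
    hls' ▸ (hasDerivAt_alphaStar hb hls).differentiableAt.hasDerivAt
  have htangent : ∀ m ∈ Set.Ioi (-(π ^ 2 / (8 * b ^ 2))),
      alphaStar b m ≤ alphaStar b lamStar + 1 / x * (m - lamStar) := by
    intro m hm
    rcases lt_trichotomy m lamStar with h | rfl | h
    · have := hconc.le_slope_of_hasDerivAt hm hls h hD
      rw [slope_def_field, le_div_iff₀ (sub_pos.2 h)] at this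
      linarith
    · simp
    · have := hconc.slope_le_of_hasDerivAt hls hm h hD
      rw [slope_def_field, div_le_iff₀ (sub_pos.2 h)] at this
      linarith
  refine ⟨fun l hl hl' => hanti.injOn hl hls ?_, ⟨⟨alphaStar b lamStar, ?_⟩, ?_⟩, ?_⟩
  · rw [← hd l hl, ← hd lamStar hls, hl', hls']
  · simp only [hVinv, mul_comm]
  · rintro _ ⟨α, rfl⟩
    have h := mul_le_mul_of_nonneg_left (htangent (V α) (hV α).1) hx.le
    rw [(hV α).2, mul_add, ← mul_assoc, mul_one_div_cancel hx.ne'] at h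
    simp only
    linarith
  · rw [hVinv, mul_comm]
end

section
/- Let $b > 0$, $x \in [0,b]$ and $\alpha \in \mathbb{R}$, and let $V(\alpha) \in (-\tfrac{\pi^2}{8b^2},\infty)$ denote the unique solution of $\alpha^*(V(\alpha)) = \alpha$, where $\alpha^*$ is the smooth extension of $\lambda \mapsto \sqrt{2\lambda}\,\tanh(b\sqrt{2\lambda})$. Consider the complex function $\hat f(\lambda) = \frac{1}{\lambda} + e^{x\sqrt{2\lambda}} A_\lambda(\alpha) + e^{-x\sqrt{2\lambda}} B_\lambda(\alpha)$, where $\sqrt{\cdot}$ is the principal branch of the complex square root, $A_\lambda(\alpha) = \dfrac{\alpha\, e^{-b\sqrt{2\lambda}}/\cosh(b\sqrt{2\lambda})}{2\lambda\,(\sqrt{2\lambda}\tanh(b\sqrt{2\lambda})-\alpha)}$ and $B_\lambda(\alpha) = e^{2b\sqrt{2\lambda}} A_\lambda(\alpha)$. Then $\hat f$ is holomorphic (complex differentiable) at every $\lambda \in \mathbb{C}$ with $\mathrm{Re}(\lambda) > \max(V(\alpha), 0)$. -/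
open scoped Real

/-- The principal square root maps the slit plane into the open right half plane. -/
lemma re_cpow_half_pos {z : ℂ} (hz : z ∈ Complex.slitPlane) : 0 < (z ^ ((1 : ℂ) / 2)).re := by
  have him : (Complex.log z * (1 / 2)).im = z.arg / 2 := by
    rw [show (1 / 2 : ℂ) = ((1 / 2 : ℝ) : ℂ) by norm_num, Complex.im_mul_ofReal, Complex.log_im]
    ring
  rw [Complex.cpow_def_of_ne_zero (Complex.slitPlane_ne_zero hz), Complex.exp_re, him]
  refine mul_pos (Real.exp_pos _) (Real.cos_pos_of_mem_Ioo ⟨?_, ?_⟩)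
  · linarith [Complex.neg_pi_lt_arg z]
  · have hlt := (Complex.arg_le_pi z).lt_of_ne (Complex.mem_slitPlane_iff_arg.mp hz).1
    linarith

lemma cpow_half_sq (z : ℂ) : (z ^ ((1 : ℂ) / 2)) ^ 2 = z := by
  rw [one_div]
  exact_mod_cast Complex.cpow_nat_inv_pow z two_ne_zero

lemma sinh_re_im (z : ℂ) : (Complex.sinh z).re = Real.sinh z.re * Real.cos z.im ∧
    (Complex.sinh z).im = Real.cosh z.re * Real.sin z.im := by
  have h : Complex.sinh z = (Real.sinh z.re * Real.cos z.im : ℝ) +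
      (Real.cosh z.re * Real.sin z.im : ℝ) * Complex.I := by
    conv_lhs => rw [← Complex.re_add_im z, Complex.sinh_add, Complex.sinh_mul_I, Complex.cosh_mul_I]
    push_cast
    ring
  rw [h]
  constructor <;> simp [-Complex.ofReal_mul]

lemma cosh_re_im (z : ℂ) : (Complex.cosh z).re = Real.cosh z.re * Real.cos z.im ∧
    (Complex.cosh z).im = Real.sinh z.re * Real.sin z.im := by
  have h : Complex.cosh z = (Real.cosh z.re * Real.cos z.im : ℝ) +
      (Real.sinh z.re * Real.sin z.im : ℝ) * Complex.I := by
    conv_lhs => rw [← Complex.re_add_im z, Complex.cosh_add, Complex.sinh_mul_I, Complex.cosh_mul_I]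
    push_cast
    ring
  rw [h]
  constructor <;> simp [-Complex.ofReal_mul]

lemma cosh_ne_zero_of_re_pos {z : ℂ} (hz : 0 < z.re) : Complex.cosh z ≠ 0 := by
  intro h
  obtain ⟨h1, h2⟩ := cosh_re_im z
  rw [h, Complex.zero_re] at h1
  rw [h, Complex.zero_im] at h2
  have hc : Real.cos z.im = 0 := by simpa [(Real.cosh_pos z.re).ne'] using h1.symm
  have hs : Real.sin z.im = 0 := by simpa [(Real.sinh_pos_iff.mpr hz).ne', hz.ne'] using h2.symm
  simpa [hc, hs] using Real.sin_sq_add_cos_sq z.im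

/-- In the right half plane, `s * tanh (b * s)` is real only for real `s`. -/
lemma im_eq_zero_of_mul_tanh_eq_ofReal {b α : ℝ} (hb : 0 < b) {s : ℂ} (hs : 0 < s.re)
    (h : s * Complex.tanh (b * s) = α) : s.im = 0 := by
  have hre : ((b : ℂ) * s).re = b * s.re := Complex.re_ofReal_mul _ _
  have him : ((b : ℂ) * s).im = b * s.im := Complex.im_ofReal_mul _ _
  have hp : 0 < b * s.re := mul_pos hb hs
  have hcosh : Complex.cosh (b * s) ≠ 0 := cosh_ne_zero_of_re_pos (hre ▸ hp)
  have h' : s * Complex.sinh (b * s) = α * Complex.cosh (b * s) := by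
    rw [← h, Complex.tanh_eq_sinh_div_cosh, mul_assoc, div_mul_cancel₀ _ hcosh]
  obtain ⟨s1, s2⟩ := sinh_re_im (b * s)
  obtain ⟨c1, c2⟩ := cosh_re_im (b * s)
  rw [hre, him] at s1 s2 c1 c2
  have e1 := congrArg Complex.re h'
  have e2 := congrArg Complex.im h'
  rw [Complex.re_ofReal_mul, Complex.mul_re, s1, s2, c1] at e1
  rw [Complex.im_ofReal_mul, Complex.mul_im, s1, s2, c2] at e2
  have hch := Real.cosh_sq (b * s.re)
  have htr := Real.sin_sq_add_cos_sq (b * s.im)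
  have hsinh : b * s.re < Real.sinh (b * s.re) := Real.self_lt_sinh_iff.mpr hp
  have hcosh1 := Real.one_le_cosh (b * s.re)
  have hsin : |Real.sin (b * s.im)| ≤ b * |s.im| := by
    simpa [abs_mul, abs_of_pos hb] using Real.abs_sin_le_abs (x := b * s.im)
  have hcos := Real.abs_cos_le_one (b * s.im)
  generalize Real.sinh (b * s.re) = S at *
  generalize Real.cosh (b * s.re) = C at *
  generalize Real.sin (b * s.im) = d at *
  generalize Real.cos (b * s.im) = c at *
  have key : s.re * (c * d) = -(s.im * (S * C)) := by
    linear_combination (C * c) * e2 - (S * d) * e1 - (s.re * c * d) * hch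
      - (s.im * S * C) * htr
  have key' : s.re * (|c| * |d|) = |s.im| * (S * C) := by
    have := congrArg abs key
    rwa [abs_neg, abs_mul, abs_mul, abs_mul, abs_of_pos hs,
      abs_of_pos (by nlinarith : 0 < S * C)] at this
  by_contra hne
  have hq : 0 < |s.im| := abs_pos.mpr hne
  have h1 : s.re * (|c| * |d|) ≤ s.re * (b * |s.im|) :=
    mul_le_mul_of_nonneg_left ((mul_le_of_le_one_left (abs_nonneg d) hcos).trans hsin) hs.le
  have h2 : b * s.re < S * C := by nlinarith
  nlinarith

lemma strictMono_real_tanh : StrictMono Real.tanh := by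
  intro u v huv
  rw [Real.tanh_eq_sinh_div_cosh, Real.tanh_eq_sinh_div_cosh,
    div_lt_div_iff₀ (Real.cosh_pos u) (Real.cosh_pos v)]
  have := Real.sinh_pos_iff.mpr (sub_pos.mpr huv)
  rw [Real.sinh_sub] at this
  linarith

lemma strictMonoOn_alphaStar_Ici {b : ℝ} (hb : 0 < b) : StrictMonoOn (alphaStar b) (Set.Ici 0) := by
  intro u hu v hv huv
  rw [Set.mem_Ici] at hu hv
  rw [alphaStar, alphaStar, if_pos hu, if_pos hv]
  have hlt : Real.sqrt (2 * u) < Real.sqrt (2 * v) := Real.sqrt_lt_sqrt (by linarith) (by linarith)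
  have h0 := Real.sqrt_nonneg (2 * u)
  have htanh := strictMono_real_tanh (mul_lt_mul_of_pos_left hlt hb)
  have hnn : 0 ≤ Real.tanh (b * Real.sqrt (2 * u)) := by
    simpa using strictMono_real_tanh.monotone (mul_nonneg hb.le h0)
  nlinarith

lemma alphaStar_nonpos_of_neg {b v : ℝ} (hb : 0 < b) (hv : -(π ^ 2 / (8 * b ^ 2)) < v)
    (hv0 : v < 0) : alphaStar b v ≤ 0 := by
  rw [alphaStar, if_neg (not_le.mpr hv0), neg_nonpos]
  refine mul_nonneg (Real.sqrt_nonneg _)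
    (Real.tan_nonneg_of_nonneg_of_le_pi_div_two (by positivity) ?_)
  have hsq : Real.sqrt (-(2 * v)) ≤ π / (2 * b) := by
    refine Real.sqrt_le_iff.mpr ⟨by positivity, ?_⟩
    have : (π / (2 * b)) ^ 2 = 2 * (π ^ 2 / (8 * b ^ 2)) := by field_simp; ring
    linarith
  calc b * Real.sqrt (-(2 * v)) ≤ b * (π / (2 * b)) := by gcongr
    _ = π / 2 := by field_simp

lemma alphaStar_lt_of_max_lt {b v u : ℝ} (hb : 0 < b) (hv : -(π ^ 2 / (8 * b ^ 2)) < v)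
    (hu : max v 0 < u) : alphaStar b v < alphaStar b u := by
  obtain ⟨hvu, hu0⟩ := max_lt_iff.mp hu
  rcases lt_or_ge v 0 with hv0 | hv0
  · refine (alphaStar_nonpos_of_neg hb hv hv0).trans_lt ?_
    have := strictMonoOn_alphaStar_Ici hb Set.self_mem_Ici hu0.le hu0
    simpa [alphaStar] using this
  · exact strictMonoOn_alphaStar_Ici hb hv0 hu0.le hvu

/-- The denominator of `A_λ(α)` has no zero to the right of `max (V(α)) 0`. -/
lemma mul_tanh_ne_alphaStar {b v : ℝ} (hb : 0 < b) (hv : -(π ^ 2 / (8 * b ^ 2)) < v) {l s : ℂ}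
    (hl : max v 0 < l.re) (hs : 0 < s.re) (hsq : s ^ 2 = 2 * l) :
    s * Complex.tanh (b * s) ≠ (alphaStar b v : ℂ) := by
  intro h
  have hs' : s = (s.re : ℂ) :=
    Complex.ext rfl (by simpa using im_eq_zero_of_mul_tanh_eq_ofReal hb hs h)
  generalize s.re = p at hs hs'
  subst hs'
  have hp : p ^ 2 = 2 * l.re := by
    have := congrArg Complex.re hsq
    rw [← Complex.ofReal_pow, Complex.ofReal_re] at this
    simpa using this
  have hval : alphaStar b l.re = p * Real.tanh (b * p) := by
    rw [alphaStar, if_pos (max_lt_iff.mp hl).2.le, ← hp, Real.sqrt_sq hs.le]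
  have := alphaStar_lt_of_max_lt hb hv hl
  rw [hval] at this
  exact this.ne' (by exact_mod_cast h)

/-- For `b > 0`, `x ∈ [0, b]`, `α ∈ ℝ` and `V(α)` the unique solution in
`(-π²/(8b²), ∞)` of `α*(V(α)) = α`, the complex function
`f̂(λ) = 1/λ + e^{x√(2λ)} A_λ(α) + e^{-x√(2λ)} B_λ(α)` (principal branch of the
square root) is holomorphic at every `λ ∈ ℂ` with `Re λ > max(V(α), 0)`. -/
theorem fhat_holomorphic_on_halfplane (b : ℝ) (hb : 0 < b)
    (x : ℝ) (hx : x ∈ Set.Icc 0 b) (α : ℝ)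
    (Vα : ℝ) (hVα : Vα ∈ Set.Ioi (-(π ^ 2 / (8 * b ^ 2))))
    (hVα' : alphaStar b Vα = α) :
    ∀ lam : ℂ, max Vα 0 < lam.re →
      DifferentiableAt ℂ (fun l : ℂ =>
        let s : ℂ := (2 * l) ^ ((1 : ℂ) / 2)
        let A : ℂ := ((α : ℂ) * Complex.exp (-(b : ℂ) * s) / Complex.cosh ((b : ℂ) * s)) /
          (2 * l * (s * Complex.tanh ((b : ℂ) * s) - (α : ℂ)))
        let B : ℂ := Complex.exp (2 * (b : ℂ) * s) * A
        1 / l + Complex.exp ((x : ℂ) * s) * A + Complex.exp (-(x : ℂ) * s) * B) lam := by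
  intro lam hlam
  have hpos : 0 < lam.re := (max_lt_iff.mp hlam).2
  have hlam0 : lam ≠ 0 := by
    rintro rfl
    simp at hpos
  have hslit : 2 * lam ∈ Complex.slitPlane := Or.inl (by simpa using hpos)
  have hs := re_cpow_half_pos hslit
  have hcosh : Complex.cosh (b * (2 * lam) ^ ((1 : ℂ) / 2)) ≠ 0 :=
    cosh_ne_zero_of_re_pos (by rw [Complex.re_ofReal_mul]; exact mul_pos hb hs)
  have hden := mul_tanh_ne_alphaStar hb hVα hlam hs (cpow_half_sq _)
  rw [hVα'] at hden
  have hsqrt : DifferentiableAt ℂ (fun l : ℂ => (2 * l) ^ ((1 : ℂ) / 2)) lam :=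
    DifferentiableAt.cpow (by fun_prop) (by fun_prop) hslit
  have hden' := mul_ne_zero (mul_ne_zero two_ne_zero hlam0) (sub_ne_zero.mpr hden)
  simp only [Complex.tanh_eq_sinh_div_cosh] at hden' ⊢
  fun_prop (disch := assumption)
end

section
/- Let $\kappa \ge 0$, $c > 0$, $C \in \mathbb{R}$, $M > 0$, let $K(t) = \dfrac{1-\cos t}{\pi t^2}$, and let $v : \mathbb{R} \to [0,M]$ be measurable, vanish on $(-\infty,0)$, and satisfy $v(t) \ge e^{-\kappa(t-s)} v(s)$ for all $t \ge s \ge 0$. Suppose $\lim_{t \to \infty} \int_{-\infty}^{ct} v(t - s/c)\,K(s)\,ds = C$. Then for every $a > 0$, $\liminf_{t \to \infty} v(t) \ge \dfrac{e^{-2\kappa a/c}}{\int_{-a}^{a} K(s)\,ds}\,\Big(C - \dfrac{4M}{\pi a}\Big)$; in particular, if $C > 0$, then $\liminf_{t\to\infty} v(t) > 0$. -/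
open scoped Real

open Filter MeasureTheory

/-- The Fejér kernel, extended continuously to `0`. -/
noncomputable def fejerKernel (t : ℝ) : ℝ :=
  if t = 0 then 1 / (2 * π) else (1 - Real.cos t) / (π * t ^ 2)

lemma fejerKernel_nonneg (t : ℝ) : 0 ≤ fejerKernel t := by
  unfold fejerKernel
  split_ifs
  · positivity
  · exact div_nonneg (by linarith [Real.cos_le_one t]) (by positivity)

lemma fejerKernel_neg (t : ℝ) : fejerKernel (-t) = fejerKernel t := by
  simp [fejerKernel]

lemma fejerKernel_pos {t : ℝ} (h0 : 0 < t) (h1 : t < π) : 0 < fejerKernel t := by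
  have h : Real.cos t < 1 := by
    simpa using Real.cos_lt_cos_of_nonneg_of_le_pi le_rfl h1.le h0
  rw [fejerKernel, if_neg h0.ne']
  exact div_pos (by linarith) (by positivity)

lemma measurable_fejerKernel : Measurable fejerKernel := by
  unfold fejerKernel
  exact Measurable.ite (measurableSet_singleton 0) (by fun_prop) (by fun_prop)

lemma fejerKernel_le_inv_sq {t : ℝ} (ht : t ≠ 0) : fejerKernel t ≤ 2 / π * (t ^ 2)⁻¹ := by
  have h : 2 / π * (t ^ 2)⁻¹ = 2 / (π * t ^ 2) := by ring
  rw [fejerKernel, if_neg ht, h]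
  gcongr
  linarith [Real.neg_one_le_cos t]

lemma fejerKernel_le_half_inv_pi (t : ℝ) : fejerKernel t ≤ 1 / (2 * π) := by
  unfold fejerKernel
  split_ifs with h
  · rfl
  · rw [div_le_div_iff₀ (by positivity) (by positivity)]
    nlinarith [Real.one_sub_sq_div_two_le_cos (x := t), Real.pi_pos]

lemma fejerKernel_le (t : ℝ) : fejerKernel t ≤ 5 / (2 * π) * (1 + t ^ 2)⁻¹ := by
  rw [← div_eq_mul_inv, le_div_iff₀ (by positivity)]
  have h1 := fejerKernel_le_half_inv_pi t
  have h2 : fejerKernel t * t ^ 2 ≤ 2 / π := by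
    rcases eq_or_ne t 0 with rfl | h
    · simp; positivity
    · have := fejerKernel_le_inv_sq h
      rwa [← div_eq_mul_inv, le_div_iff₀ (by positivity)] at this
  have h3 : 5 / (2 * π) = 1 / (2 * π) + 2 / π := by field_simp; norm_num
  linarith

lemma integrable_fejerKernel : Integrable fejerKernel := by
  refine (integrable_inv_one_add_sq.const_mul (5 / (2 * π))).mono'
    measurable_fejerKernel.aestronglyMeasurable (.of_forall fun t => ?_)
  rw [Real.norm_of_nonneg (fejerKernel_nonneg t)]
  exact fejerKernel_le t

lemma setIntegral_Ioi_fejerKernel_le {a : ℝ} (ha : 0 < a) :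
    ∫ s in Set.Ioi a, fejerKernel s ≤ 2 / (π * a) := by
  have hint : IntegrableOn (fun s : ℝ => 2 / π * s ^ (-2 : ℝ)) (Set.Ioi a) :=
    (integrableOn_Ioi_rpow_of_lt (by norm_num) ha).const_mul _
  calc ∫ s in Set.Ioi a, fejerKernel s
      ≤ ∫ s in Set.Ioi a, 2 / π * s ^ (-2 : ℝ) := by
        refine setIntegral_mono_on integrable_fejerKernel.integrableOn hint measurableSet_Ioi
          fun s hs => ?_
        have hs0 : 0 < s := ha.trans hs
        rw [Real.rpow_neg hs0.le, Real.rpow_two]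
        exact fejerKernel_le_inv_sq hs0.ne'
    _ = 2 / (π * a) := by
        rw [integral_const_mul, integral_Ioi_rpow_of_lt (by norm_num) ha]
        norm_num [Real.rpow_neg_one]
        field_simp

lemma setIntegral_compl_Icc_fejerKernel_le {a : ℝ} (ha : 0 < a) :
    ∫ s in (Set.Icc (-a) a)ᶜ, fejerKernel s ≤ 4 / (π * a) := by
  have hset : (Set.Icc (-a) a)ᶜ = Set.Iio (-a) ∪ Set.Ioi a := by
    ext s
    simp only [Set.mem_compl_iff, Set.mem_Icc, Set.mem_union, Set.mem_Iio, Set.mem_Ioi]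
    rw [not_and_or, not_le, not_le]
  have hdisj : Disjoint (Set.Iio (-a)) (Set.Ioi a) :=
    Set.disjoint_left.2 fun s (h1 : s < -a) (h2 : a < s) => by linarith
  have hleft : ∫ s in Set.Iio (-a), fejerKernel s = ∫ s in Set.Ioi a, fejerKernel s := by
    rw [← integral_Iic_eq_integral_Iio, ← integral_comp_neg_Ioi]
    simp [fejerKernel_neg]
  rw [hset, setIntegral_union hdisj measurableSet_Ioi integrable_fejerKernel.integrableOn
    integrable_fejerKernel.integrableOn, hleft]
  have := setIntegral_Ioi_fejerKernel_le ha
  have h : 4 / (π * a) = 2 / (π * a) + 2 / (π * a) := by ring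
  linarith

lemma setIntegral_Icc_fejerKernel_pos {a : ℝ} (ha : 0 < a) :
    0 < ∫ s in Set.Icc (-a) a, fejerKernel s := by
  rw [setIntegral_pos_iff_support_of_nonneg_ae (.of_forall fejerKernel_nonneg)
    integrable_fejerKernel.integrableOn]
  have hsub : Set.Ioo 0 (min a π) ⊆ Function.support fejerKernel ∩ Set.Icc (-a) a :=
    fun s ⟨h0, h1⟩ => ⟨(fejerKernel_pos h0 (h1.trans_le (min_le_right _ _))).ne',
      by linarith, (h1.trans_le (min_le_left _ _)).le⟩
  refine lt_of_lt_of_le ?_ (measure_mono hsub)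
  simp [ha, Real.pi_pos]

/-- Splitting a Fejér average of `0 ≤ w ≤ M` into the window `[-a, a]`, where `w ≤ B`, and its
complement. -/
lemma setIntegral_mul_fejerKernel_le {w : ℝ → ℝ} {M B a : ℝ} (hw : Measurable w)
    (hw_mem : ∀ s, w s ∈ Set.Icc 0 M) (ha : 0 < a) (hB : ∀ s ∈ Set.Icc (-a) a, w s ≤ B)
    (S : Set ℝ) :
    ∫ s in S, w s * fejerKernel s ≤
      B * (∫ s in Set.Icc (-a) a, fejerKernel s) + 4 * M / (π * a) := by
  have hM : 0 ≤ M := (hw_mem 0).1.trans (hw_mem 0).2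
  have hint : Integrable fun s => w s * fejerKernel s := by
    refine integrable_fejerKernel.bdd_mul (c := M) hw.aestronglyMeasurable (.of_forall fun s => ?_)
    rw [Real.norm_of_nonneg (hw_mem s).1]
    exact (hw_mem s).2
  have hwindow : ∫ s in Set.Icc (-a) a, w s * fejerKernel s ≤
      B * ∫ s in Set.Icc (-a) a, fejerKernel s := by
    rw [← integral_const_mul]
    exact setIntegral_mono_on hint.integrableOn (integrable_fejerKernel.const_mul B).integrableOn
      measurableSet_Icc fun s hs => mul_le_mul_of_nonneg_right (hB s hs) (fejerKernel_nonneg s)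
  have htail : ∫ s in (Set.Icc (-a) a)ᶜ, w s * fejerKernel s ≤ 4 * M / (π * a) := by
    calc ∫ s in (Set.Icc (-a) a)ᶜ, w s * fejerKernel s
        ≤ ∫ s in (Set.Icc (-a) a)ᶜ, M * fejerKernel s :=
          setIntegral_mono hint.integrableOn (integrable_fejerKernel.const_mul M).integrableOn
            fun s => mul_le_mul_of_nonneg_right (hw_mem s).2 (fejerKernel_nonneg s)
      _ = M * ∫ s in (Set.Icc (-a) a)ᶜ, fejerKernel s := integral_const_mul _ _
      _ ≤ M * (4 / (π * a)) :=
          mul_le_mul_of_nonneg_left (setIntegral_compl_Icc_fejerKernel_le ha) hM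
      _ = 4 * M / (π * a) := by ring
  calc ∫ s in S, w s * fejerKernel s
      ≤ ∫ s, w s * fejerKernel s :=
        setIntegral_le_integral hint
          (.of_forall fun s => mul_nonneg (hw_mem s).1 (fejerKernel_nonneg s))
    _ = (∫ s in Set.Icc (-a) a, w s * fejerKernel s) +
          ∫ s in (Set.Icc (-a) a)ᶜ, w s * fejerKernel s :=
        (integral_add_compl measurableSet_Icc hint).symm
    _ ≤ _ := add_le_add hwindow htail

/-- Lower-bound step of the Tauberian argument: if `0 ≤ v ≤ M` vanishes on `(-∞, 0)`,
satisfies `v(t) ≥ e^{-κ(t-s)} v(s)` for `t ≥ s ≥ 0`, and the Fejér averages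
`∫_{-∞}^{ct} v(t - s/c) K(s) ds` converge to `C` as `t → ∞`, then for every `a > 0`,
`liminf_{t→∞} v(t) ≥ e^{-2κa/c} (C - 4M/(πa)) / ∫_{-a}^{a} K`; in particular, if
`C > 0` then `liminf v > 0`. -/
theorem tauberian_liminf_bound (κ c C M : ℝ) (hκ : 0 ≤ κ) (hc : 0 < c) (hM : 0 < M)
    (K : ℝ → ℝ)
    (hK : ∀ t : ℝ, K t = if t = 0 then 1 / (2 * π) else (1 - Real.cos t) / (π * t ^ 2))
    (v : ℝ → ℝ) (hv_meas : Measurable v) (hv_mem : ∀ t, v t ∈ Set.Icc 0 M)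
    (hv_zero : ∀ t : ℝ, t < 0 → v t = 0)
    (hv_mono : ∀ s t : ℝ, 0 ≤ s → s ≤ t → Real.exp (-κ * (t - s)) * v s ≤ v t)
    (hlim : Filter.Tendsto (fun t : ℝ => ∫ s in Set.Iic (c * t), v (t - s / c) * K s)
      Filter.atTop (nhds C)) :
    (∀ a : ℝ, 0 < a →
      (Real.exp (-(2 * κ * a / c)) / ∫ s in Set.Icc (-a) a, K s) * (C - 4 * M / (π * a)) ≤
        Filter.liminf v Filter.atTop) ∧
    (0 < C → 0 < Filter.liminf v Filter.atTop) := by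
  obtain rfl : K = fejerKernel := funext fun t => (hK t).trans rfl
  have key : ∀ a : ℝ, 0 < a →
      (Real.exp (-(2 * κ * a / c)) / ∫ s in Set.Icc (-a) a, fejerKernel s) *
        (C - 4 * M / (π * a)) ≤ Filter.liminf v Filter.atTop := by
    intro a ha
    have hI := setIntegral_Icc_fejerKernel_pos ha
    set I := ∫ s in Set.Icc (-a) a, fejerKernel s
    have hshift : Tendsto (fun u : ℝ => u - a / c) atTop atTop :=
      tendsto_atTop_add_const_right _ (-(a / c)) tendsto_id
    have hT := ((hlim.comp hshift).sub_const (4 * M / (π * a))).const_mul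
      (Real.exp (-(2 * κ * a / c)) / I)
    rw [← hT.liminf_eq]
    refine liminf_le_liminf ?_ hT.isBoundedUnder_ge
      (isBoundedUnder_of ⟨M, fun t => (hv_mem t).2⟩).isCoboundedUnder_ge
    filter_upwards [eventually_ge_atTop (2 * (a / c))] with u hu
    have hB : ∀ s ∈ Set.Icc (-a) a,
        v (u - a / c - s / c) ≤ Real.exp (2 * κ * a / c) * v u := by
      rintro s ⟨hs1, hs2⟩
      have h1 : s / c ≤ a / c := by gcongr
      have h2 : -(a / c) ≤ s / c := by rw [← neg_div]; gcongr
      have hmono := hv_mono (u - a / c - s / c) u (by linarith) (by linarith)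
      have hexp : Real.exp (-(2 * κ * a / c)) ≤
          Real.exp (-κ * (u - (u - a / c - s / c))) := by
        apply Real.exp_le_exp.2
        have h3 := mul_le_mul_of_nonneg_left h1 hκ
        have h4 : 2 * κ * a / c = 2 * (κ * (a / c)) := by ring
        rw [h4]
        linarith
      have := (mul_le_mul_of_nonneg_right hexp (hv_mem _).1).trans hmono
      rwa [Real.exp_neg, inv_mul_le_iff₀ (Real.exp_pos _)] at this
    have hF := setIntegral_mul_fejerKernel_le (w := fun s => v (u - a / c - s / c))
      (hv_meas.comp (by fun_prop)) (fun s => hv_mem _) ha hB (Set.Iic (c * (u - a / c)))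
    simp only [Function.comp_apply]
    rw [Real.exp_neg, inv_eq_one_div, div_div, div_mul_eq_mul_div, one_mul,
      div_le_iff₀ (by positivity)]
    linarith
  refine ⟨key, fun hC => ?_⟩
  have ha : 0 < 8 * M / (π * C) := by positivity
  refine lt_of_lt_of_le ?_ (key _ ha)
  have hI := setIntegral_Icc_fejerKernel_pos ha
  have h : 4 * M / (π * (8 * M / (π * C))) = C / 2 := by field_simp; norm_num
  rw [h]
  exact mul_pos (div_pos (Real.exp_pos _) hI) (by linarith)
end
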